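/- For every ε > 0 there exist constants d_0 and τ > 0 with the following property. Suppose 0 < p(n) < 1 with p(n) = o(1), set d(n) = n·p(n), and suppose d(n) ≥ d_0 for all sufficiently large n. If t(n) is a sequence of nonnegative integers with t(n) ≤ τ·ln d(n), then asymptotically almost surely (1 − ε)·d(n)/(2 ln d(n)) ≤ χ^{t(n)}(G(n,p(n))) ≤ (1 + ε)·d(n)/(2 ln d(n)). -/

import Mathlib

open MeasureTheory Filter
open scoped ENNReal NNReal

/-- The Bernoulli(p) measure on `Bool`. -/
noncomputable def bernoulliBool (p : ℝ) : Measure Bool :=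
  p.toNNReal • Measure.dirac true + (1 - p).toNNReal • Measure.dirac false

instance (p : ℝ) : IsFiniteMeasure (bernoulliBool p) := by
  unfold bernoulliBool; infer_instance

instance (n : ℕ) : MeasurableSpace (SimpleGraph (Fin n)) := ⊤

/-- The Erdős–Rényi random graph `G(n,p)`: the distribution of the simple graph on `Fin n`
obtained by including each possible edge independently with probability `p`. -/
noncomputable def erMeasure (n : ℕ) (p : ℝ) : Measure (SimpleGraph (Fin n)) :=
  Measure.map (fun f : Sym2 (Fin n) → Bool => SimpleGraph.fromEdgeSet {e | f e = true})
    (Measure.pi fun _ : Sym2 (Fin n) => bernoulliBool p)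

/-- A set `S` of vertices is `t`-dependent if the induced subgraph has maximum degree at most `t`,
i.e. every vertex of `S` has at most `t` neighbours inside `S`. -/
def IsTDependent {V : Type*} (G : SimpleGraph V) (t : ℕ) (S : Set V) : Prop :=
  ∀ v ∈ S, {u ∈ S | G.Adj v u}.ncard ≤ t

/-- The `t`-improper chromatic number: the least number of colours in a vertex colouring
in which every colour class is `t`-dependent. -/
noncomputable def improperChromaticNumber {V : Type*} (G : SimpleGraph V) (t : ℕ) : ℕ :=
  sInf {k | ∃ c : V → Fin k, ∀ i : Fin k, IsTDependent G t {v | c v = i}}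

/-- The `t`-dependence number: the maximum size of a `t`-dependent set. -/
noncomputable def tDependenceNumber {V : Type*} (G : SimpleGraph V) (t : ℕ) : ℕ :=
  sSup {m | ∃ S : Set V, S.ncard = m ∧ IsTDependent G t S}

/-- The Fenchel–Legendre transform `Λ*(x) = x ln(x/p) + (1-x) ln((1-x)/(1-p))`
(with the conventions `Λ*(0) = ln(1/(1-p))`, `Λ*(1) = ln(1/p)`, which hold automatically
since `Real.log 0 = 0` in Lean). -/
noncomputable def LambdaStar (p x : ℝ) : ℝ :=
  x * Real.log (x / p) + (1 - x) * Real.log ((1 - x) / (1 - p))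

section WeightedSums

variable {ι κ Ω : Type*} [Fintype ι] [DecidableEq ι] [Fintype κ]
  [DecidableEq κ] [Fintype Ω]

/-- Expectation of `F` under the product of the weights `w` over the index type `ι`. -/
noncomputable def wexp (w : Ω → ℝ) (F : (ι → Ω) → ℝ) : ℝ := ∑ f, (∏ i, w (f i)) * F f

theorem wexp_mono {w : Ω → ℝ} (hw : ∀ b, 0 ≤ w b) {F G : (ι → Ω) → ℝ} (h : ∀ f, F f ≤ G f) :
    wexp w F ≤ wexp w G :=
  Finset.sum_le_sum fun f _ =>
    mul_le_mul_of_nonneg_left (h f) (Finset.prod_nonneg fun i _ => hw (f i))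

theorem wexp_nonneg {w : Ω → ℝ} (hw : ∀ b, 0 ≤ w b) {F : (ι → Ω) → ℝ} (h : ∀ f, 0 ≤ F f) :
    0 ≤ wexp w F :=
  Finset.sum_nonneg fun f _ => mul_nonneg (Finset.prod_nonneg fun i _ => hw (f i)) (h f)

theorem wexp_add (w : Ω → ℝ) (F G : (ι → Ω) → ℝ) :
    wexp w (fun f => F f + G f) = wexp w F + wexp w G := by
  simp only [wexp, mul_add, Finset.sum_add_distrib]

theorem wexp_const_mul (w : Ω → ℝ) (c : ℝ) (F : (ι → Ω) → ℝ) :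
    wexp w (fun f => c * F f) = c * wexp w F := by
  simp only [wexp, Finset.mul_sum]
  exact Finset.sum_congr rfl fun f _ => by ring

theorem wexp_sum {α : Type*} (w : Ω → ℝ) (s : Finset α) (F : α → (ι → Ω) → ℝ) :
    wexp w (fun f => ∑ a ∈ s, F a f) = ∑ a ∈ s, wexp w (F a) := by
  simp only [wexp, Finset.mul_sum]
  exact Finset.sum_comm

theorem wexp_prod (w : Ω → ℝ) (h : ι → Ω → ℝ) :
    wexp w (fun f => ∏ i, h i (f i)) = ∏ i, ∑ b, w b * h i b := by
  rw [Finset.prod_univ_sum, Fintype.piFinset_univ, wexp]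
  exact Finset.sum_congr rfl fun f _ => by rw [Finset.prod_mul_distrib]

theorem wexp_const {w : Ω → ℝ} (hw : ∑ b, w b = 1) (c : ℝ) :
    wexp w (fun _ : ι → Ω => c) = c := by
  have := wexp_prod (ι := ι) w (fun _ _ => 1)
  simp only [Finset.prod_const_one, mul_one, hw] at this
  have h2 := wexp_const_mul (ι := ι) w c (fun _ => 1)
  simp only [mul_one, this] at h2
  exact h2

theorem wexp_sq_le {w : Ω → ℝ} (hw : ∀ b, 0 ≤ w b) (F G : (ι → Ω) → ℝ) :
    (wexp w (fun f => F f * G f)) ^ 2 ≤ wexp w (fun f => F f ^ 2) * wexp w (fun f => G f ^ 2) := by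
  have := Finset.sum_mul_sq_le_sq_mul_sq (Finset.univ : Finset (ι → Ω))
    (fun f => √(∏ i, w (f i)) * F f) (fun f => √(∏ i, w (f i)) * G f)
  have e : ∀ f : ι → Ω, √(∏ i, w (f i)) ^ 2 = ∏ i, w (f i) := fun f =>
    Real.sq_sqrt (Finset.prod_nonneg fun i _ => hw (f i))
  simp only [mul_pow, e] at this
  have e' : ∀ f : ι → Ω, √(∏ i, w (f i)) * F f * (√(∏ i, w (f i)) * G f)
      = (∏ i, w (f i)) * (F f * G f) := fun f => by
    conv_rhs => rw [← e f]
    ring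
  simp only [e'] at this
  exact this

theorem wexp_fin_succ {n : ℕ} (w : Ω → ℝ) (F : (Fin (n + 1) → Ω) → ℝ) :
    wexp w F = ∑ b, w b * wexp w (fun y : Fin n → Ω => F (Fin.cons b y)) := by
  simp only [wexp, Finset.mul_sum]
  rw [← (Fin.consEquiv fun _ => Ω).sum_comp, Fintype.sum_prod_type]
  refine Finset.sum_congr rfl fun b _ => Finset.sum_congr rfl fun y _ => ?_
  simp [Fin.consEquiv, Fin.prod_univ_succ, mul_assoc]

/-- Marginalisation: coordinates outside the range of an injection integrate out. -/
theorem wexp_comp_injective [DecidableEq Ω] {w : Ω → ℝ} (hw : ∑ b, w b = 1) {g : ι → κ}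
    (hg : Function.Injective g) (H : (ι → Ω) → ℝ) :
    wexp w (fun x : κ → Ω => H (fun i => x (g i))) = wexp w H := by
  have key : ∀ f : ι → Ω, wexp w (fun x : κ → Ω => if (fun i => x (g i)) = f then (1 : ℝ) else 0)
      = ∏ i, w (f i) := by
    intro f
    have e1 : ∀ x : κ → Ω, (if (fun i => x (g i)) = f then (1 : ℝ) else 0)
        = ∏ j, (if ∀ i, g i = j → x j = f i then (1 : ℝ) else 0) := by
      intro x
      by_cases hx : (fun i => x (g i)) = f
      · rw [if_pos hx, Finset.prod_eq_one]
        intro j _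
        rw [if_pos]
        rintro i rfl
        exact congrFun hx i
      · rw [if_neg hx]
        obtain ⟨i, hi⟩ := Function.ne_iff.mp hx
        rw [Finset.prod_eq_zero (Finset.mem_univ (g i))]
        rw [if_neg]
        intro h
        exact hi (h i rfl)
    simp only [e1]
    rw [wexp_prod w (fun j b => if ∀ i, g i = j → b = f i then (1 : ℝ) else 0)]
    rw [← Finset.prod_subset (Finset.subset_univ (Finset.univ.image g)),
      Finset.prod_image (fun a _ b _ h => hg h)]
    · refine Finset.prod_congr rfl fun i _ => ?_
      rw [Finset.sum_eq_single (f i)]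
      · simp only [mul_ite, mul_one, mul_zero]
        rw [if_pos]
        intro i' h; rw [hg h]
      · intro b _ hb
        rw [if_neg, mul_zero]
        intro h; exact hb (h i rfl)
      · simp
    · intro j _ hj
      refine Eq.trans (Finset.sum_congr rfl fun b _ => ?_) hw
      rw [if_pos, mul_one]
      rintro i rfl
      exact absurd (Finset.mem_image_of_mem g (Finset.mem_univ i)) hj
  have e2 : ∀ x : κ → Ω, H (fun i => x (g i))
      = ∑ f : ι → Ω, H f * (if (fun i => x (g i)) = f then (1 : ℝ) else 0) := by
    intro x; simp
  simp only [e2]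
  rw [wexp_sum]
  simp only [wexp_const_mul, key]
  exact Finset.sum_congr rfl fun f _ => mul_comm _ _

/-- The exponential-moment form of the bounded differences inequality. -/
theorem wexp_exp_sub_mean_le {w : Ω → ℝ} (hw0 : ∀ b, 0 ≤ w b) (hw : ∑ b, w b = 1) (s : ℝ) :
    ∀ (n : ℕ) (F : (Fin n → Ω) → ℝ),
      (∀ x y v, (∀ u, u ≠ v → x u = y u) → F x ≤ F y + 1) →
      wexp w (fun x => Real.exp (s * (F x - wexp w F))) ≤ Real.exp (s ^ 2 / 2 * n) := by
  intro n
  induction n with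
  | zero =>
    intro F _
    have : ∀ x : Fin 0 → Ω, wexp w F = F x := by
      intro x
      rw [← wexp_const (ι := Fin 0) hw (F x)]
      congr 1
      ext y
      rw [Subsingleton.elim x y]
    simp only [← this, sub_self, mul_zero, Real.exp_zero, wexp_const hw]
    simp
  | succ n ih =>
    intro F hF
    set m : Ω → ℝ := fun b => wexp w (fun y : Fin n → Ω => F (Fin.cons b y)) with hm
    have hmean : wexp w F = ∑ b, w b * m b := wexp_fin_succ w F
    have hmm : ∀ b b', m b ≤ m b' + 1 := by
      intro b b'
      calc m b ≤ wexp w (fun y : Fin n → Ω => F (Fin.cons b' y) + 1) := by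
            refine wexp_mono hw0 fun y => hF _ _ 0 fun u hu => ?_
            obtain ⟨j, rfl⟩ := Fin.exists_succ_eq.mpr hu
            simp
        _ = m b' + 1 := by rw [wexp_add, wexp_const hw]
    have hdev : ∀ b, |m b - wexp w F| ≤ 1 := by
      intro b
      rw [hmean, abs_le]
      have e : m b = ∑ b', w b' * m b := by rw [← Finset.sum_mul, hw, one_mul]
      have e1 : (1 : ℝ) = ∑ b', w b' * 1 := by rw [← Finset.sum_mul, hw, one_mul]
      constructor
      · have : ∑ b', w b' * m b' ≤ ∑ b', (w b' * m b + w b' * 1) :=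
          Finset.sum_le_sum fun b' _ => by
            rw [← mul_add]; exact mul_le_mul_of_nonneg_left (hmm b' b) (hw0 b')
        rw [Finset.sum_add_distrib, ← e, ← e1] at this
        linarith
      · have : ∑ b', w b' * m b ≤ ∑ b', (w b' * m b' + w b' * 1) :=
          Finset.sum_le_sum fun b' _ => by
            rw [← mul_add]; exact mul_le_mul_of_nonneg_left (hmm b b') (hw0 b')
        rw [Finset.sum_add_distrib, ← e, ← e1] at this
        linarith
    rw [wexp_fin_succ]
    have step : ∀ b, wexp w (fun y : Fin n → Ω => Real.exp (s * (F (Fin.cons b y) - wexp w F)))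
        ≤ Real.exp (s * (m b - wexp w F)) * Real.exp (s ^ 2 / 2 * n) := by
      intro b
      have := ih (fun y => F (Fin.cons b y)) (by
        intro x y v h
        refine hF _ _ v.succ fun u hu => ?_
        refine Fin.cases ?_ (fun j hj => ?_) u hu
        · simp
        · simp only [Fin.cons_succ]
          exact h j fun hjv => hj (by rw [hjv]))
      calc _ = Real.exp (s * (m b - wexp w F)) *
            wexp w (fun y : Fin n → Ω => Real.exp (s * (F (Fin.cons b y) - m b))) := by
            rw [← wexp_const_mul]
            congr 1; ext y
            rw [← Real.exp_add]; congr 1; ring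
        _ ≤ _ := mul_le_mul_of_nonneg_left this (Real.exp_pos _).le
    have hoeff : ∑ b, w b * Real.exp (s * (m b - wexp w F)) ≤ Real.exp (s ^ 2 / 2) := by
      have pt : ∀ x : ℝ, |x| ≤ 1 → Real.exp (s * x) ≤ Real.cosh s + x * Real.sinh s := by
        intro x hx
        rw [abs_le] at hx
        have := convexOn_exp.2 (Set.mem_univ s) (Set.mem_univ (-s))
          (show 0 ≤ (1 + x) / 2 by linarith) (show 0 ≤ (1 - x) / 2 by linarith) (by ring)
        simp only [smul_eq_mul] at this
        rw [Real.cosh_eq, Real.sinh_eq]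
        calc Real.exp (s * x) = Real.exp ((1 + x) / 2 * s + (1 - x) / 2 * -s) := by
              congr 1; ring
          _ ≤ _ := this
          _ = _ := by ring
      calc _ ≤ ∑ b, (w b * Real.cosh s + (w b * m b - w b * wexp w F) * Real.sinh s) := by
            refine Finset.sum_le_sum fun b _ => ?_
            have := mul_le_mul_of_nonneg_left (pt _ (hdev b)) (hw0 b)
            linarith
        _ = Real.cosh s := by
            rw [Finset.sum_add_distrib, ← Finset.sum_mul, hw, ← Finset.sum_mul,
              Finset.sum_sub_distrib, ← hmean, ← Finset.sum_mul, hw]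
            ring
        _ ≤ _ := Real.cosh_le_exp_half_sq s
    calc _ ≤ ∑ b, w b * (Real.exp (s * (m b - wexp w F)) * Real.exp (s ^ 2 / 2 * n)) :=
          Finset.sum_le_sum fun b _ => mul_le_mul_of_nonneg_left (step b) (hw0 b)
      _ = (∑ b, w b * Real.exp (s * (m b - wexp w F))) * Real.exp (s ^ 2 / 2 * n) := by
          rw [Finset.sum_mul]; exact Finset.sum_congr rfl fun b _ => by ring
      _ ≤ Real.exp (s ^ 2 / 2) * Real.exp (s ^ 2 / 2 * n) :=
          mul_le_mul_of_nonneg_right hoeff (Real.exp_pos _).le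
      _ = _ := by rw [← Real.exp_add]; congr 1; push_cast; ring

end WeightedSums

section EdgeProbability

variable {ι : Type*} [Fintype ι] [DecidableEq ι]

/-- The weights of a Bernoulli(p) variable. -/
def bernoulliWeight (p : ℝ) : Bool → ℝ := fun b => if b then p else 1 - p

theorem bernoulliWeight_nonneg {p : ℝ} (h0 : 0 ≤ p) (h1 : p ≤ 1) (b : Bool) :
    0 ≤ bernoulliWeight p b := by
  cases b <;> simp [bernoulliWeight, h0, h1]

theorem sum_bernoulliWeight (p : ℝ) : ∑ b, bernoulliWeight p b = 1 := by
  simp [bernoulliWeight]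

open Classical in
/-- The probability of the event `Q` under independent Bernoulli(p) variables. -/
noncomputable def bernoulliPr (p : ℝ) (Q : (ι → Bool) → Prop) : ℝ :=
  wexp (bernoulliWeight p) (fun f => if Q f then 1 else 0)

theorem bernoulliPr_mono {p : ℝ} (h0 : 0 ≤ p) (h1 : p ≤ 1) {Q R : (ι → Bool) → Prop}
    (h : ∀ f, Q f → R f) : bernoulliPr p Q ≤ bernoulliPr p R := by
  refine wexp_mono (bernoulliWeight_nonneg h0 h1) fun f => ?_
  by_cases hQ : Q f
  · simp [hQ, h f hQ]
  · simp only [hQ, if_false]; split_ifs <;> norm_num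

theorem bernoulliPr_nonneg {p : ℝ} (h0 : 0 ≤ p) (h1 : p ≤ 1) (Q : (ι → Bool) → Prop) :
    0 ≤ bernoulliPr p Q :=
  wexp_nonneg (bernoulliWeight_nonneg h0 h1) fun f => by split_ifs <;> norm_num

theorem bernoulliPr_add_not (p : ℝ) (Q : (ι → Bool) → Prop) :
    bernoulliPr p Q + bernoulliPr p (fun f => ¬ Q f) = 1 := by
  unfold bernoulliPr
  rw [← wexp_add]
  refine Eq.trans ?_ (wexp_const (ι := ι) (sum_bernoulliWeight p) 1)
  congr 1; ext f
  by_cases h : Q f <;> simp [h]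

theorem bernoulliPr_or_le {p : ℝ} (h0 : 0 ≤ p) (h1 : p ≤ 1) (Q R : (ι → Bool) → Prop) :
    bernoulliPr p (fun f => Q f ∨ R f) ≤ bernoulliPr p Q + bernoulliPr p R := by
  unfold bernoulliPr
  rw [← wexp_add]
  refine wexp_mono (bernoulliWeight_nonneg h0 h1) fun f => ?_
  by_cases h : Q f <;> by_cases h' : R f <;> simp [h, h']

theorem bernoulliPr_exists_le {α : Type*} {p : ℝ} (h0 : 0 ≤ p) (h1 : p ≤ 1) (s : Finset α)
    (Q : α → (ι → Bool) → Prop) :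
    bernoulliPr p (fun f => ∃ a ∈ s, Q a f) ≤ ∑ a ∈ s, bernoulliPr p (Q a) := by
  classical
  unfold bernoulliPr
  rw [← wexp_sum]
  refine wexp_mono (bernoulliWeight_nonneg h0 h1) fun f => ?_
  have hn : ∀ a ∈ s, (0 : ℝ) ≤ if Q a f then 1 else 0 := fun a _ => by split_ifs <;> norm_num
  by_cases h : ∃ a ∈ s, Q a f
  · obtain ⟨a, ha, hQ⟩ := h
    rw [if_pos ⟨a, ha, hQ⟩]
    refine le_trans ?_ (Finset.single_le_sum hn ha)
    simp [hQ]
  · rw [if_neg h]; exact Finset.sum_nonneg hn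

theorem mul_bernoulliPr_le {p : ℝ} (h0 : 0 ≤ p) (h1 : p ≤ 1) {F : (ι → Bool) → ℝ}
    (hF : ∀ f, 0 ≤ F f) {a : ℝ} {Q : (ι → Bool) → Prop} (hQ : ∀ f, Q f → a ≤ F f) :
    a * bernoulliPr p Q ≤ wexp (bernoulliWeight p) F := by
  unfold bernoulliPr
  rw [← wexp_const_mul]
  refine wexp_mono (bernoulliWeight_nonneg h0 h1) fun f => ?_
  by_cases h : Q f
  · simpa [h] using hQ f h
  · simpa [h] using hF f

theorem wexp_bernoulliWeight_prod (p : ℝ) (T : Finset ι) (h : Bool → ℝ) :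
    wexp (bernoulliWeight p) (fun f => ∏ e ∈ T, h (f e)) = (p * h true + (1 - p) * h false) ^ T.card := by
  have := wexp_prod (bernoulliWeight p) (fun (e : ι) b => if e ∈ T then h b else 1)
  simp only [Finset.prod_ite_mem, Finset.univ_inter] at this
  rw [this]
  have h2 : ∀ e : ι, ∑ b, bernoulliWeight p b * (if e ∈ T then h b else 1)
      = if e ∈ T then p * h true + (1 - p) * h false else 1 := by
    intro e
    by_cases he : e ∈ T <;> simp [he, bernoulliWeight]
  simp only [h2, Finset.prod_ite_mem, Finset.univ_inter, Finset.prod_const]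

theorem bernoulliPr_forall_eq (p : ℝ) (T : Finset ι) (b : Bool) :
    bernoulliPr p (fun f => ∀ e ∈ T, f e = b) = bernoulliWeight p b ^ T.card := by
  have := wexp_bernoulliWeight_prod p T (fun c => if c = b then 1 else 0)
  simp only [Finset.prod_boole] at this
  unfold bernoulliPr
  convert this using 2
  · ext f; congr
  · cases b <;> simp [bernoulliWeight]

/-- An edge set contains many open edges with probability at most the expected number of
all-open subsets. -/
theorem bernoulliPr_le_card_filter_le {p : ℝ} (h0 : 0 ≤ p) (h1 : p ≤ 1) (T : Finset ι) (r : ℕ) :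
    bernoulliPr p (fun f => r ≤ (T.filter (fun e => f e = true)).card)
      ≤ T.card.choose r * p ^ r := by
  calc _ ≤ bernoulliPr p (fun f => ∃ R ∈ T.powersetCard r, ∀ e ∈ R, f e = true) := by
        refine bernoulliPr_mono h0 h1 fun f hf => ?_
        obtain ⟨R, hR, hRc⟩ := Finset.exists_subset_card_eq hf
        refine ⟨R, Finset.mem_powersetCard.2 ⟨hR.trans (Finset.filter_subset _ _), hRc⟩, ?_⟩
        intro e he
        exact (Finset.mem_filter.1 (hR he)).2
    _ ≤ ∑ R ∈ T.powersetCard r, bernoulliPr p (fun f => ∀ e ∈ R, f e = true) :=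
        bernoulliPr_exists_le h0 h1 _ _
    _ = ∑ R ∈ T.powersetCard r, p ^ r := by
        refine Finset.sum_congr rfl fun R hR => ?_
        rw [bernoulliPr_forall_eq, (Finset.mem_powersetCard.1 hR).2]
        rfl
    _ = _ := by rw [Finset.sum_const, Finset.card_powersetCard, nsmul_eq_mul]

/-- The lower-tail Chernoff bound for the number of open edges. -/
theorem bernoulliPr_card_filter_le {p : ℝ} (h0 : 0 ≤ p) (h1 : p ≤ 1) (T : Finset ι) {u : ℝ}
    (hu : 0 ≤ u) (a : ℝ) :
    bernoulliPr p (fun f => ((T.filter (fun e => f e = true)).card : ℝ) ≤ a)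
      ≤ Real.exp (u * a - p * (1 - Real.exp (-u)) * T.card) := by
  have key := mul_bernoulliPr_le h0 h1 (F := fun f => ∏ e ∈ T, if f e = true then Real.exp (-u) else 1)
    (fun f => Finset.prod_nonneg fun e _ => by split_ifs <;> positivity)
    (a := Real.exp (-(u * a))) (Q := fun f => ((T.filter (fun e => f e = true)).card : ℝ) ≤ a) (by
      intro f hf
      rw [← Finset.prod_filter, Finset.prod_const, ← Real.exp_nat_mul]
      refine Real.exp_le_exp.2 ?_
      nlinarith)
  rw [wexp_bernoulliWeight_prod p T (fun b => if b = true then Real.exp (-u) else 1)] at key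
  have h2 : (p * (if true = true then Real.exp (-u) else 1) +
      (1 - p) * (if false = true then Real.exp (-u) else 1)) ^ T.card
      ≤ Real.exp (-(p * (1 - Real.exp (-u))) * T.card) := by
    rw [mul_comm _ (T.card : ℝ), Real.exp_nat_mul]
    refine pow_le_pow_left₀ ?_ ?_ _
    · have := Real.exp_pos (-u)
      simp; nlinarith [mul_nonneg h0 this.le]
    · have := Real.add_one_le_exp (-(p * (1 - Real.exp (-u))))
      simp only [if_true, Bool.false_eq_true, if_false]; linarith
  have h3 := key.trans h2
  rw [Real.exp_neg, inv_mul_le_iff₀ (Real.exp_pos _), ← Real.exp_add] at h3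
  refine h3.trans (Real.exp_le_exp.2 (by linarith))

end EdgeProbability

section RandomGraph

variable {n : ℕ}

theorem bernoulliBool_singleton {p : ℝ} (b : Bool) :
    bernoulliBool p {b} = ENNReal.ofReal (bernoulliWeight p b) := by
  cases b <;> simp [bernoulliBool, bernoulliWeight, ENNReal.ofReal]

theorem erMeasure_apply {p : ℝ} (h0 : 0 ≤ p) (h1 : p ≤ 1) (A : Set (SimpleGraph (Fin n))) :
    erMeasure n p A = ENNReal.ofReal (bernoulliPr p
      (fun f : Sym2 (Fin n) → Bool => SimpleGraph.fromEdgeSet {e | f e = true} ∈ A)) := by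
  classical
  have hmeas : Measurable
      (fun f : Sym2 (Fin n) → Bool => SimpleGraph.fromEdgeSet {e | f e = true}) :=
    measurable_of_finite _
  rw [erMeasure, Measure.map_apply hmeas (by trivial)]
  set B := (fun f : Sym2 (Fin n) → Bool => SimpleGraph.fromEdgeSet {e | f e = true}) ⁻¹' A with hB
  have e : B = ((Finset.univ.filter (fun f => f ∈ B) : Finset (Sym2 (Fin n) → Bool)) : Set _) := by
    ext; simp
  rw [e, ← sum_measure_singleton]
  simp only [Measure.pi_singleton, bernoulliBool_singleton]
  unfold bernoulliPr wexp
  have hb := bernoulliWeight_nonneg h0 h1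
  rw [ENNReal.ofReal_sum_of_nonneg]
  · rw [Finset.sum_filter]
    refine Finset.sum_congr rfl fun f _ => ?_
    rw [← ENNReal.ofReal_prod_of_nonneg fun i _ => hb _]
    beta_reduce
    by_cases hf : f ∈ B
    · rw [if_pos hf, if_pos (show SimpleGraph.fromEdgeSet {e | f e = true} ∈ A from hf), mul_one]
    · rw [if_neg hf, if_neg (show SimpleGraph.fromEdgeSet {e | f e = true} ∉ A from hf), mul_zero,
        ENNReal.ofReal_zero]
  · intro f _
    beta_reduce
    refine mul_nonneg (Finset.prod_nonneg fun i _ => hb _) (by split_ifs <;> norm_num)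

theorem wexp_curry {Ω : Type*} [Fintype Ω] (w : Ω → ℝ) (F : (Fin n × Fin n → Ω) → ℝ) :
    wexp w F = wexp (fun x : Fin n → Ω => ∏ u, w (x u))
      (fun x : Fin n → Fin n → Ω => F (fun q => x q.1 q.2)) := by
  unfold wexp
  refine Fintype.sum_equiv (Equiv.curry (Fin n) (Fin n) Ω) _ _ fun x => ?_
  rw [Fintype.prod_prod_type]
  rfl

/-- Bounded differences with respect to vertex exposure. -/
theorem wexp_exp_sub_mean_le_of_vertex {p : ℝ} (h0 : 0 ≤ p) (h1 : p ≤ 1) (s : ℝ)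
    (Y : (Sym2 (Fin n) → Bool) → ℝ)
    (hY : ∀ f g v, (∀ e : Sym2 (Fin n), v ∉ e → f e = g e) → Y f ≤ Y g + 1) :
    wexp (bernoulliWeight p) (fun f => Real.exp (s * (Y f - wexp (bernoulliWeight p) Y)))
      ≤ Real.exp (s ^ 2 / 2 * n) := by
  have hinj : Function.Injective (fun e : Sym2 (Fin n) => ((e.sup, e.inf) : Fin n × Fin n)) := by
    intro e e' h
    simp only [Prod.mk.injEq] at h
    exact Sym2.inf_eq_inf_and_sup_eq_sup.1 ⟨h.2, h.1⟩
  have hb := sum_bernoulliWeight p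
  have hmean : wexp (bernoulliWeight p) Y =
      wexp (fun x : Fin n → Bool => ∏ u, bernoulliWeight p (x u))
        (fun x : Fin n → Fin n → Bool => Y (fun e => x e.sup e.inf)) := by
    rw [← wexp_comp_injective hb hinj Y, wexp_curry]
  rw [← wexp_comp_injective hb hinj (fun f => Real.exp (s * (Y f - wexp (bernoulliWeight p) Y))),
    wexp_curry, hmean]
  refine wexp_exp_sub_mean_le
    (fun x => Finset.prod_nonneg fun u _ => bernoulliWeight_nonneg h0 h1 _) ?_ s n
    (fun x : Fin n → Fin n → Bool => Y (fun e => x e.sup e.inf)) ?_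
  · have := wexp_const (ι := Fin n) hb 1
    simpa [wexp] using this
  · intro x y v hxy
    refine hY _ _ v fun e he => ?_
    have : e.sup ≠ v := by
      rintro rfl
      apply he
      induction e using Sym2.inductionOn with
      | hf a b =>
        rw [Sym2.sup_mk]
        rcases le_total a b with h | h
        · rw [sup_eq_right.2 h]; exact Sym2.mem_mk_right _ _
        · rw [sup_eq_left.2 h]; exact Sym2.mem_mk_left _ _
    exact congrFun (hxy _ this) _

end RandomGraph

section Occupancy

/-- `binomialMean q a g` is the expectation of `g` at a Binomial(a, q) variable. -/
noncomputable def binomialMean (q : ℝ) : ℕ → (ℕ → ℝ) → ℝ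
  | 0, g => g 0
  | a + 1, g => (1 - q) * binomialMean q a g + q * binomialMean q a (fun l => g (l + 1))

theorem binomialMean_mono {q : ℝ} (h0 : 0 ≤ q) (h1 : q ≤ 1) :
    ∀ (a : ℕ) {g h : ℕ → ℝ}, (∀ l ≤ a, g l ≤ h l) → binomialMean q a g ≤ binomialMean q a h
  | 0, _, _, H => H 0 le_rfl
  | a + 1, g, h, H => by
    have h2 := binomialMean_mono h0 h1 a (g := g) (h := h) fun l hl => H l (by omega)
    have h3 := binomialMean_mono h0 h1 a (g := fun l => g (l + 1)) (h := fun l => h (l + 1))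
      fun l hl => H (l + 1) (by omega)
    simp only [binomialMean]
    exact add_le_add (mul_le_mul_of_nonneg_left h2 (by linarith)) (mul_le_mul_of_nonneg_left h3 h0)

theorem binomialMean_const_mul (q c : ℝ) :
    ∀ (a : ℕ) (g : ℕ → ℝ), binomialMean q a (fun l => c * g l) = c * binomialMean q a g
  | 0, g => rfl
  | a + 1, g => by
    simp only [binomialMean, binomialMean_const_mul q c a]; ring

theorem binomialMean_add (q : ℝ) :
    ∀ (a : ℕ) (g h : ℕ → ℝ),
      binomialMean q a (fun l => g l + h l) = binomialMean q a g + binomialMean q a h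
  | 0, _, _ => rfl
  | a + 1, g, h => by
    simp only [binomialMean]
    rw [binomialMean_add q a g h, binomialMean_add q a (fun l => g (l + 1)) (fun l => h (l + 1))]
    ring

theorem binomialMean_zero (q : ℝ) (a : ℕ) : binomialMean q a (fun _ => 0) = 0 := by
  simpa using binomialMean_const_mul q 0 a (fun _ => 0)

theorem binomialMean_sum {α : Type*} (q : ℝ) (a : ℕ) (s : Finset α) (g : α → ℕ → ℝ) :
    binomialMean q a (fun l => ∑ j ∈ s, g j l) = ∑ j ∈ s, binomialMean q a (g j) := by
  classical
  induction s using Finset.induction_on with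
  | empty => simpa using binomialMean_zero q a
  | insert x s hx ih =>
    simp only [Finset.sum_insert hx]
    rw [binomialMean_add, ih]

theorem binomialMean_nonneg {q : ℝ} (h0 : 0 ≤ q) (h1 : q ≤ 1) (a : ℕ) {g : ℕ → ℝ}
    (hg : ∀ l, 0 ≤ g l) : 0 ≤ binomialMean q a g := by
  rw [← binomialMean_zero q a]; exact binomialMean_mono h0 h1 a fun l _ => hg l

theorem binomialMean_exp (q θ : ℝ) :
    ∀ a : ℕ, binomialMean q a (fun l => Real.exp (θ * l)) = (1 - q + q * Real.exp θ) ^ a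
  | 0 => by simp [binomialMean]
  | a + 1 => by
    have : (fun l : ℕ => Real.exp (θ * ((l + 1 : ℕ) : ℝ)))
        = fun l : ℕ => Real.exp θ * Real.exp (θ * l) := by
      ext l; rw [← Real.exp_add]; congr 1; push_cast; ring
    simp only [binomialMean]
    rw [this, binomialMean_const_mul, binomialMean_exp q θ a]
    ring

theorem binomialMean_indicator_le {q : ℝ} (h0 : 0 ≤ q) (h1 : q ≤ 1) :
    ∀ a j : ℕ, binomialMean q a (fun l => if l = j then 1 else 0) ≤ a.choose j * q ^ j
  | 0, 0 => by simp [binomialMean]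
  | 0, j + 1 => by simp [binomialMean]
  | a + 1, 0 => by
    have h2 := binomialMean_indicator_le h0 h1 a 0
    simp only [Nat.choose_zero_right, Nat.cast_one, pow_zero, mul_one] at h2
    simp only [binomialMean, Nat.add_eq_zero_iff, one_ne_zero, and_false, if_false,
      binomialMean_zero]
    simp only [Nat.choose_zero_right, Nat.cast_one, pow_zero, mul_one, mul_zero, add_zero]
    nlinarith
  | a + 1, j + 1 => by
    have h2 := binomialMean_indicator_le h0 h1 a (j + 1)
    have h3 := binomialMean_indicator_le h0 h1 a j
    simp only [binomialMean, Nat.add_right_cancel_iff]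
    rw [Nat.choose_succ_succ]
    push_cast
    have h4 := mul_le_mul_of_nonneg_left h2 (sub_nonneg.2 h1)
    have h5 := mul_le_mul_of_nonneg_left h3 h0
    have h6 : 0 ≤ q * ((a.choose (j + 1) : ℝ) * q ^ (j + 1)) := by positivity
    have h7 : q * ((a.choose j : ℝ) * q ^ j) = a.choose j * q ^ (j + 1) := by ring
    nlinarith

theorem prod_add_sum_mul_prod_erase_le {α : Type*} [DecidableEq α] (s : Finset α) (a e : α → ℝ)
    (ha : ∀ z, 0 ≤ a z) (he : ∀ z, 0 ≤ e z) :
    ∏ z ∈ s, a z + ∑ z ∈ s, e z * ∏ y ∈ s.erase z, a y ≤ ∏ z ∈ s, (a z + e z) := by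
  induction s using Finset.induction_on with
  | empty => simp
  | insert x s hx ih =>
    rw [Finset.prod_insert hx, Finset.prod_insert hx, Finset.sum_insert hx,
      Finset.erase_insert hx]
    have h1 : ∑ z ∈ s, e z * ∏ y ∈ (insert x s).erase z, a y
        = a x * ∑ z ∈ s, e z * ∏ y ∈ s.erase z, a y := by
      rw [Finset.mul_sum]
      refine Finset.sum_congr rfl fun z hz => ?_
      have hzx : x ≠ z := by rintro rfl; exact hx hz
      rw [Finset.erase_insert_of_ne hzx, Finset.prod_insert (fun h => hx (Finset.mem_of_mem_erase h))]
      ring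
    rw [h1]
    have hS : 0 ≤ ∑ z ∈ s, e z * ∏ y ∈ s.erase z, a y :=
      Finset.sum_nonneg fun z _ => mul_nonneg (he z) (Finset.prod_nonneg fun y _ => ha y)
    nlinarith [mul_le_mul_of_nonneg_left ih (ha x), mul_le_mul_of_nonneg_left ih (he x),
      mul_nonneg (he x) hS]

/-- The occupation numbers of the cells of a contingency table whose columns are chosen
uniformly at random are negatively associated. -/
theorem wexp_prod_occupancy_le {R C : Type*} [Fintype R] [DecidableEq R] [Fintype C]
    [DecidableEq C] [Nonempty C] :
    ∀ (n : ℕ) (σ : Fin n → R) (F : R × C → ℕ → ℝ), (∀ z, Monotone (F z)) → (∀ z l, 0 ≤ F z l) →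
      wexp (fun _ : C => (1 / Fintype.card C : ℝ))
        (fun τ : Fin n → C => ∏ z, F z (Finset.univ.filter fun v => (σ v, τ v) = z).card)
      ≤ ∏ z, binomialMean (1 / Fintype.card C) (Finset.univ.filter fun v => σ v = z.1).card (F z) := by
  have hk : (0 : ℝ) < Fintype.card C := by exact_mod_cast Fintype.card_pos
  set q : ℝ := 1 / Fintype.card C with hq
  have hq0 : 0 ≤ q := by positivity
  have hq1 : q ≤ 1 := by
    rw [hq, div_le_one hk]; exact_mod_cast Fintype.card_pos (α := C)
  have hqs : ∑ _c : C, q = 1 := by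
    rw [Finset.sum_const, Finset.card_univ, nsmul_eq_mul, hq]; field_simp
  intro n
  induction n with
  | zero =>
    intro σ F _ _
    simp [binomialMean, wexp_const hqs]
  | succ n ih =>
    intro σ F hF hF0
    rw [wexp_fin_succ]
    set N : R → ℕ := fun i => (Finset.univ.filter fun v : Fin n => σ v.succ = i).card with hN
    set a : R × C → ℝ := fun z => binomialMean q (N z.1) (F z) with ha
    set b : R × C → ℝ := fun z => binomialMean q (N z.1) (fun l => F z (l + 1)) with hb
    have ha0 : ∀ z, 0 ≤ a z := fun z => binomialMean_nonneg hq0 hq1 _ (hF0 z)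
    have hab : ∀ z, a z ≤ b z := fun z =>
      binomialMean_mono hq0 hq1 _ fun l _ => hF z (Nat.le_succ l)
    have step : ∀ c, wexp (fun _ : C => q) (fun y : Fin n → C => ∏ z, F z
        (Finset.univ.filter fun v => (σ v, (Fin.cons c y : Fin (n + 1) → C) v) = z).card)
        ≤ ∏ z, a z + (b (σ 0, c) - a (σ 0, c)) * ∏ y ∈ Finset.univ.erase (σ 0, c), a y := by
      intro c
      have := ih (fun v => σ v.succ) (fun z l => F z (l + if (σ 0, c) = z then 1 else 0))
        (fun z l m h => hF z (by omega)) (fun z l => hF0 z _)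
      refine le_trans (le_of_eq ?_) (this.trans (le_of_eq ?_))
      · congr 1; ext y
        refine Finset.prod_congr rfl fun z _ => ?_
        rw [Fin.card_filter_univ_succ]
        simp only [Fin.cons_zero, Fin.cons_succ]
        split_ifs <;> simp
      · rw [← Finset.mul_prod_erase _ _ (Finset.mem_univ (σ 0, c)),
          ← Finset.mul_prod_erase _ a (Finset.mem_univ (σ 0, c))]
        have e1 : ∏ z ∈ Finset.univ.erase (σ 0, c), binomialMean q
            (Finset.univ.filter fun v : Fin n => σ v.succ = z.1).card
            (fun l => F z (l + if (σ 0, c) = z then 1 else 0))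
            = ∏ z ∈ Finset.univ.erase (σ 0, c), a z := by
          refine Finset.prod_congr rfl fun z hz => ?_
          simp [(Finset.ne_of_mem_erase hz).symm, ha, hN]
        rw [e1]
        simp only [if_true, hb, hN]
        ring
    calc _ ≤ ∑ c, q * (∏ z, a z +
          (b (σ 0, c) - a (σ 0, c)) * ∏ y ∈ Finset.univ.erase (σ 0, c), a y) :=
          Finset.sum_le_sum fun c _ => mul_le_mul_of_nonneg_left (step c) hq0
      _ = ∏ z, a z + ∑ z : R × C, (if z.1 = σ 0 then q * (b z - a z) else 0) *
            ∏ y ∈ Finset.univ.erase z, a y := by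
          simp only [mul_add]
          rw [Finset.sum_add_distrib, ← Finset.sum_mul, hqs, one_mul, Fintype.sum_prod_type]
          congr 1
          rw [Finset.sum_eq_single (σ 0)]
          · simp [mul_assoc]
          · intro i _ hi; simp [hi]
          · simp
      _ ≤ ∏ z, (a z + if z.1 = σ 0 then q * (b z - a z) else 0) := by
          refine prod_add_sum_mul_prod_erase_le _ _ _ ha0 fun z => ?_
          split_ifs
          · exact mul_nonneg hq0 (sub_nonneg.2 (hab z))
          · exact le_rfl
      _ = _ := by
          refine Finset.prod_congr rfl fun z _ => ?_
          rw [Fin.card_filter_univ_succ]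
          by_cases h : σ 0 = z.1
          · rw [if_pos h.symm, if_pos h]
            simp only [binomialMean, ha, hb, hN]
            ring
          · rw [if_neg (Ne.symm h), if_neg h]
            simp [ha, hN]

end Occupancy

section SecondMoment

variable {n : ℕ}

/-- The pairs of distinct vertices that get equal labels under `ρ`. -/
def monoPairs {X : Type*} [DecidableEq X] (ρ : Fin n → X) : Finset (Sym2 (Fin n)) :=
  Finset.univ.filter fun e => ¬ e.IsDiag ∧ (e.map ρ).IsDiag

theorem mk_mem_monoPairs {X : Type*} [DecidableEq X] {ρ : Fin n → X} {u v : Fin n} :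
    s(u, v) ∈ monoPairs ρ ↔ u ≠ v ∧ ρ u = ρ v := by
  simp [monoPairs]

theorem monoPairs_inter {X Y : Type*} [DecidableEq X] [DecidableEq Y] (ρ : Fin n → X)
    (τ : Fin n → Y) : monoPairs ρ ∩ monoPairs τ = monoPairs fun v => (ρ v, τ v) := by
  ext e
  induction e using Sym2.inductionOn with
  | hf u v =>
    simp only [Finset.mem_inter, mk_mem_monoPairs, Prod.mk.injEq]
    tauto

theorem card_monoPairs_le {X : Type*} [DecidableEq X] [Fintype X] (ρ : Fin n → X) :
    (monoPairs ρ).card ≤ ∑ z, (Finset.univ.filter fun v => ρ v = z).card.choose 2 := by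
  calc _ ≤ (Finset.univ.biUnion fun z =>
        (Finset.univ.filter fun v => ρ v = z).offDiag.image (Function.uncurry Sym2.mk)).card := by
        refine Finset.card_le_card fun e => ?_
        induction e using Sym2.inductionOn with
        | hf u v =>
          intro h
          rw [mk_mem_monoPairs] at h
          rw [Finset.mem_biUnion]
          refine ⟨ρ v, Finset.mem_univ _, Finset.mem_image.2 ⟨(u, v), ?_, rfl⟩⟩
          simp [h.1, h.2]
    _ ≤ _ := by
        refine Finset.card_biUnion_le.trans (le_of_eq ?_)
        exact Finset.sum_congr rfl fun z _ => Sym2.card_image_offDiag _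

theorem bernoulliPr_proper_and (p : ℝ) {X Y : Type*} [DecidableEq X] [DecidableEq Y]
    (ρ : Fin n → X) (τ : Fin n → Y) :
    bernoulliPr p (fun f => (∀ e ∈ monoPairs ρ, f e = false) ∧ ∀ e ∈ monoPairs τ, f e = false)
      = (1 - p) ^ (monoPairs ρ ∪ monoPairs τ).card := by
  have := bernoulliPr_forall_eq p (monoPairs ρ ∪ monoPairs τ) false
  simp only [Finset.mem_union, or_imp, forall_and] at this
  exact this

/-- Second moment lower bound for the probability of being properly colourable, in terms of a
family `B` of colourings all of whose classes have size at most `M`. -/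
theorem card_le_bernoulliPr_colourable {k : ℕ} [NeZero k] {p : ℝ} (h0 : 0 ≤ p) (h1 : p < 1)
    (B : Finset (Fin n → Fin k)) {M G : ℝ}
    (hB : ∀ σ ∈ B, ∀ i, ((Finset.univ.filter fun v => σ v = i).card : ℝ) ≤ M)
    (hG : ∀ a : ℕ, (a : ℝ) ≤ M →
      binomialMean (1 / k) a (fun l => (1 - p)⁻¹ ^ l.choose 2) ≤ Real.exp G) :
    (B.card : ℝ) ≤ (k : ℝ) ^ n * Real.exp ((k : ℝ) ^ 2 * G) *
      bernoulliPr p (fun f : Sym2 (Fin n) → Bool =>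
        ∃ σ : Fin n → Fin k, ∀ e ∈ monoPairs σ, f e = false) := by
  classical
  set x : ℝ := (1 - p)⁻¹ with hx
  have hp : 0 < 1 - p := by linarith
  have hx1 : 1 ≤ x := one_le_inv_iff₀.2 ⟨hp, by linarith⟩
  have hx0 : 0 < x := by positivity
  have hk : (0 : ℝ) < k := by exact_mod_cast Nat.pos_of_ne_zero (NeZero.ne k)
  set ind : (Fin n → Fin k) → (Sym2 (Fin n) → Bool) → ℝ := fun σ f =>
    if ∀ e ∈ monoPairs σ, f e = false then 1 else 0 with hind
  set Z : (Sym2 (Fin n) → Bool) → ℝ := fun f => ∑ σ ∈ B, x ^ (monoPairs σ).card * ind σ f with hZ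
  set Q : (Sym2 (Fin n) → Bool) → Prop := fun f =>
    ∃ σ : Fin n → Fin k, ∀ e ∈ monoPairs σ, f e = false with hQ
  have hw := bernoulliWeight_nonneg h0 h1.le
  have hEind : ∀ σ, wexp (bernoulliWeight p) (ind σ) = (1 - p) ^ (monoPairs σ).card := by
    intro σ
    have := bernoulliPr_forall_eq p (monoPairs σ) false
    unfold bernoulliPr at this
    simp only [hind]
    convert this using 2
    · ext f; congr
    · rfl
  have hEind2 : ∀ σ τ, wexp (bernoulliWeight p) (fun f => ind σ f * ind τ f)
      = (1 - p) ^ (monoPairs σ ∪ monoPairs τ).card := by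
    intro σ τ
    rw [← bernoulliPr_proper_and]
    unfold bernoulliPr
    congr 1; ext f
    simp only [hind]
    by_cases h : ∀ e ∈ monoPairs σ, f e = false <;>
      by_cases h' : ∀ e ∈ monoPairs τ, f e = false
    · rw [if_pos h, if_pos h', if_pos ⟨h, h'⟩, mul_one]
    · rw [if_neg h', mul_zero, if_neg fun hc => h' hc.2]
    · rw [if_neg h, zero_mul, if_neg fun hc => h hc.1]
    · rw [if_neg h, zero_mul, if_neg fun hc => h hc.1]
  have hEZ : wexp (bernoulliWeight p) Z = B.card := by
    simp only [hZ]
    rw [wexp_sum]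
    simp only [wexp_const_mul, hEind, ← mul_pow]
    simp [hx, hp.ne']
  have hZQ : ∀ f, Z f = Z f * (if Q f then 1 else 0) := by
    intro f
    by_cases h : Q f
    · simp [h]
    · simp only [h, if_false, mul_zero, hZ]
      refine Finset.sum_eq_zero fun σ _ => ?_
      simp only [hind]
      rw [if_neg, mul_zero]
      exact fun h' => h ⟨σ, h'⟩
  have hrow : ∀ σ ∈ B, ∑ τ : Fin n → Fin k, x ^ (monoPairs σ ∩ monoPairs τ).card
      ≤ (k : ℝ) ^ n * Real.exp ((k : ℝ) ^ 2 * G) := by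
    intro σ hσ
    have hocc := wexp_prod_occupancy_le n σ (fun (_ : Fin k × Fin k) l => x ^ l.choose 2)
      (fun _ l m h => pow_le_pow_right₀ hx1 (Nat.choose_le_choose 2 h))
      (fun _ l => by positivity)
    simp only [Fintype.card_fin] at hocc
    have hle : ∏ z : Fin k × Fin k, binomialMean (1 / (k : ℝ))
        (Finset.univ.filter fun v => σ v = z.1).card (fun l => x ^ l.choose 2)
        ≤ Real.exp ((k : ℝ) ^ 2 * G) := by
      calc _ ≤ ∏ _z : Fin k × Fin k, Real.exp G := by
            refine Finset.prod_le_prod (fun z _ => ?_) fun z _ => hG _ (hB σ hσ z.1)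
            refine binomialMean_nonneg (by positivity) ?_ _ fun l => by positivity
            rw [div_le_one hk]; exact_mod_cast Nat.pos_of_ne_zero (NeZero.ne k)
        _ = _ := by
            rw [Finset.prod_const, Finset.card_univ, ← Real.exp_nat_mul]
            simp [sq]
    have h2 := hocc.trans hle
    have e : wexp (fun _ : Fin k => (1 / k : ℝ)) (fun τ : Fin n → Fin k => ∏ z : Fin k × Fin k,
        x ^ (Finset.univ.filter fun v => (σ v, τ v) = z).card.choose 2)
        = (1 / (k : ℝ)) ^ n * ∑ τ : Fin n → Fin k,
          x ^ ∑ z : Fin k × Fin k, (Finset.univ.filter fun v => (σ v, τ v) = z).card.choose 2 := by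
      rw [wexp, Finset.mul_sum]
      refine Finset.sum_congr rfl fun τ _ => ?_
      rw [Finset.prod_pow_eq_pow_sum]
      simp
    rw [e, one_div, inv_pow, inv_mul_le_iff₀ (by positivity)] at h2
    refine le_trans (Finset.sum_le_sum fun τ _ => ?_) h2
    rw [monoPairs_inter]
    exact pow_le_pow_right₀ hx1 (card_monoPairs_le _)
  have hEZ2 : wexp (bernoulliWeight p) (fun f => Z f ^ 2)
      ≤ B.card * ((k : ℝ) ^ n * Real.exp ((k : ℝ) ^ 2 * G)) := by
    have e : ∀ f, Z f ^ 2 = ∑ σ ∈ B, ∑ τ ∈ B,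
        (x ^ (monoPairs σ).card * x ^ (monoPairs τ).card) * (ind σ f * ind τ f) := by
      intro f
      simp only [hZ, sq, Finset.sum_mul_sum]
      exact Finset.sum_congr rfl fun σ _ => Finset.sum_congr rfl fun τ _ => by ring
    simp only [e]
    rw [wexp_sum]
    rw [← nsmul_eq_mul]
    refine Finset.sum_le_card_nsmul _ _ _ fun σ hσ => ?_
    rw [wexp_sum]
    refine le_trans ?_ (hrow σ hσ)
    refine le_trans (Finset.sum_le_sum fun τ _ => ?_)
      (Finset.sum_le_sum_of_subset_of_nonneg (Finset.subset_univ B)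
        fun τ _ _ => (pow_pos hx0 _).le)
    rw [wexp_const_mul, hEind2]
    have hc := Finset.card_union_add_card_inter (monoPairs σ) (monoPairs τ)
    rw [← pow_add, ← hc, pow_add]
    have : x ^ (monoPairs σ ∪ monoPairs τ).card * (1 - p) ^ (monoPairs σ ∪ monoPairs τ).card = 1 := by
      rw [← mul_pow, hx, inv_mul_cancel₀ hp.ne', one_pow]
    refine le_of_eq ?_
    calc _ = (x ^ (monoPairs σ ∪ monoPairs τ).card * (1 - p) ^ (monoPairs σ ∪ monoPairs τ).card) *
          x ^ (monoPairs σ ∩ monoPairs τ).card := by ring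
      _ = _ := by rw [this, one_mul]
  have hCS := wexp_sq_le hw Z (fun f => if Q f then (1 : ℝ) else 0)
  have e1 : wexp (bernoulliWeight p) (fun f => Z f * if Q f then (1 : ℝ) else 0) = B.card := by
    rw [← hEZ]; congr 1; ext f; exact (hZQ f).symm
  have e2 : wexp (bernoulliWeight p) (fun f => (if Q f then (1 : ℝ) else 0) ^ 2)
      = bernoulliPr p Q := by
    unfold bernoulliPr
    congr 1; ext f
    by_cases h : Q f <;> simp [h]
  rw [e1, e2] at hCS
  have hPr := bernoulliPr_nonneg h0 h1.le Q
  rcases (Nat.cast_nonneg (α := ℝ) B.card).eq_or_lt with h | h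
  · rw [← h]; positivity
  · have := hCS.trans (mul_le_mul_of_nonneg_right hEZ2 hPr)
    rw [sq, mul_assoc] at this
    exact le_of_mul_le_mul_left this h

end SecondMoment

section OverlapBound

theorem choose_le_exp {a j : ℕ} (hj : 0 < j) {M : ℝ} (ha : (a : ℝ) ≤ M) (hM : 0 < M) :
    (a.choose j : ℝ) ≤ Real.exp (j * (1 + Real.log (M / j))) := by
  have hj' : (0 : ℝ) < j := by exact_mod_cast hj
  have h1 := Nat.choose_le_pow_div (α := ℝ) j a
  have h2 := Real.pow_div_factorial_le_exp (j : ℝ) hj'.le j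
  have h3 : (0 : ℝ) < j.factorial := by exact_mod_cast j.factorial_pos
  rw [div_le_iff₀ h3] at h2
  rw [mul_add, Real.exp_add, mul_one, Real.exp_nat_mul, Real.exp_log (by positivity), div_pow]
  refine h1.trans ?_
  rw [div_le_iff₀ h3]
  calc (a : ℝ) ^ j ≤ M ^ j := by gcongr
    _ = (j : ℝ) ^ j * (M ^ j / j ^ j) := by field_simp
    _ ≤ (Real.exp j * j.factorial) * (M ^ j / j ^ j) := by gcongr
    _ = _ := by ring

theorem binomialMean_exp_choose_two_le {k M l θ η L : ℝ} (hk : 1 ≤ k) (hl : 0 < l)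
    (hθ : 0 < θ) (hθ1 : θ ≤ 1) (hη : 0 < η) (hη1 : η ≤ 1 / 16) (hL : 0 < L)
    (h1 : l * M / 2 ≤ (1 - 4 * η) * L) (h2 : (1 - η) * L ≤ Real.log k)
    (h3 : 1 + Real.log (l * M / (2 * θ)) ≤ η * L) (h4 : 1 ≤ η * M)
    (a : ℕ) (ha : (a : ℝ) ≤ M) :
    binomialMean (1 / k) a (fun j => Real.exp (l * (j.choose 2 : ℕ)))
      ≤ Real.exp (2 * θ * M / k + M * Real.exp (-(3 / 2) * L)) := by
  have hM : 0 < M := pos_of_mul_pos_right (by linarith) hη.le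
  have hk0 : 0 < k := by linarith
  have hq0 : 0 ≤ 1 / k := by positivity
  have hq1 : 1 / k ≤ 1 := by rw [div_le_one hk0]; exact hk
  have hch : ∀ j : ℕ, ((j.choose 2 : ℕ) : ℝ) = j * (j - 1) / 2 := fun j => Nat.cast_choose_two ℝ j
  set J := (Finset.Icc 2 a).filter fun j : ℕ => 2 * θ / l < j with hJ
  have hpt : ∀ j ≤ a, Real.exp (l * (j.choose 2 : ℕ)) ≤ Real.exp (θ * j) +
      ∑ i ∈ J, Real.exp (l * (i.choose 2 : ℕ)) * (if j = i then 1 else 0) := by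
    intro j hj
    have hs : 0 ≤ ∑ i ∈ J, Real.exp (l * (i.choose 2 : ℕ)) * (if j = i then (1 : ℝ) else 0) :=
      Finset.sum_nonneg fun i _ => mul_nonneg (Real.exp_pos _).le (by split_ifs <;> norm_num)
    by_cases hjJ : j ∈ J
    · have : Real.exp (l * (j.choose 2 : ℕ)) * (if j = j then (1 : ℝ) else 0)
        ≤ ∑ i ∈ J, Real.exp (l * (i.choose 2 : ℕ)) * (if j = i then (1 : ℝ) else 0) :=
        Finset.single_le_sum (f := fun i : ℕ => Real.exp (l * (i.choose 2 : ℕ)) *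
          (if j = i then (1 : ℝ) else 0))
          (fun i _ => mul_nonneg (Real.exp_pos _).le (by split_ifs <;> norm_num)) hjJ
      simp only [if_true, mul_one] at this
      linarith [Real.exp_pos (θ * j)]
    · have : Real.exp (l * (j.choose 2 : ℕ)) ≤ Real.exp (θ * j) := by
        rw [Real.exp_le_exp, hch]
        by_cases hj2 : 2 ≤ j
        · have h : (j : ℝ) ≤ 2 * θ / l := by
            by_contra hc
            exact hjJ (by simp [hJ, hj, hj2, not_le.1 hc])
          rw [le_div_iff₀ hl] at h
          have : (0 : ℝ) ≤ j := by positivity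
          nlinarith
        · have h : (0 : ℝ) ≤ j := by positivity
          interval_cases j
          · simp
          · simpa using hθ.le
      linarith
  have hterm : ∀ i ∈ J, Real.exp (l * (i.choose 2 : ℕ)) * ((a.choose i : ℝ) * (1 / k) ^ i)
      ≤ Real.exp (-(3 / 2) * L) := by
    intro i hi
    simp only [hJ, Finset.mem_filter, Finset.mem_Icc] at hi
    obtain ⟨⟨hi2, hia⟩, hil⟩ := hi
    have hi2' : (2 : ℝ) ≤ i := by exact_mod_cast hi2
    have hiM : (i : ℝ) ≤ M := le_trans (by exact_mod_cast hia) ha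
    have hi0 : (0 : ℝ) < i := by linarith
    have e : (1 / k) ^ i = Real.exp (-(i * Real.log k)) := by
      rw [Real.exp_neg, Real.exp_nat_mul, Real.exp_log hk0, one_div, inv_pow]
    have hc := choose_le_exp (show 0 < i by omega) ha hM
    calc _ ≤ Real.exp (l * (i.choose 2 : ℕ)) *
          (Real.exp (i * (1 + Real.log (M / i))) * Real.exp (-(i * Real.log k))) := by
          rw [e]; gcongr
      _ = Real.exp (l * (i.choose 2 : ℕ) + (i * (1 + Real.log (M / i)) + -(i * Real.log k))) := by
          rw [Real.exp_add, Real.exp_add]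
      _ ≤ _ := by
          rw [Real.exp_le_exp, hch]
          have hlog : 1 + Real.log (M / i) ≤ η * L := by
            refine le_trans ?_ h3
            have : M / i ≤ l * M / (2 * θ) := by
              rw [div_lt_iff₀ hl] at hil
              rw [div_le_div_iff₀ hi0 (by positivity)]
              nlinarith
            have := Real.log_le_log (by positivity) this
            linarith
          have hA : l * (i - 1) / 2 ≤ (1 - 4 * η) * L * (i / M) := by
            rw [← mul_div_assoc, le_div_iff₀ hM]
            nlinarith
          have hB : (i : ℝ) * (i / M) ≤ (1 + 2 / M) * i - 2 := by
            have : 0 ≤ ((i : ℝ) - 2) * (M - i) / M :=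
              div_nonneg (mul_nonneg (by linarith) (by linarith)) hM.le
            have e : ((i : ℝ) - 2) * (M - i) / M = (1 + 2 / M) * i - 2 - i * (i / M) := by
              field_simp; ring
            linarith
          have hMη : 1 / M ≤ η := by rw [div_le_iff₀ hM]; linarith
          have hC : (i : ℝ) * (2 * η - 1 + (1 - 4 * η) * (i / M)) ≤ -(3 / 2) := by
            have e2 : 2 / M = 2 * (1 / M) := by ring
            have : (1 - 4 * η) * ((i : ℝ) * (i / M)) ≤ (1 - 4 * η) * ((1 + 2 * η) * i - 2) := by
              refine mul_le_mul_of_nonneg_left (hB.trans ?_) (by linarith)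
              rw [e2]; nlinarith
            nlinarith [mul_pos (mul_pos hη hη) hi0]
          calc _ = (i : ℝ) * (l * (i - 1) / 2 + (1 + Real.log (M / i)) - Real.log k) := by ring
            _ ≤ i * ((1 - 4 * η) * L * (i / M) + η * L - (1 - η) * L) := by gcongr
            _ = (i : ℝ) * (2 * η - 1 + (1 - 4 * η) * (i / M)) * L := by ring
            _ ≤ _ := by gcongr
  have hmain : binomialMean (1 / k) a (fun j => Real.exp (l * (j.choose 2 : ℕ)))
      ≤ (1 - 1 / k + 1 / k * Real.exp θ) ^ a + ∑ i ∈ J, Real.exp (l * (i.choose 2 : ℕ)) *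
        ((a.choose i : ℝ) * (1 / k) ^ i) := by
    refine (binomialMean_mono hq0 hq1 a hpt).trans ?_
    rw [binomialMean_add, binomialMean_exp, binomialMean_sum]
    refine add_le_add le_rfl (Finset.sum_le_sum fun i _ => ?_)
    rw [binomialMean_const_mul]
    exact mul_le_mul_of_nonneg_left (binomialMean_indicator_le hq0 hq1 a i) (Real.exp_pos _).le
  have hfirst : (1 - 1 / k + 1 / k * Real.exp θ) ^ a ≤ Real.exp (2 * θ * M / k) := by
    have he : Real.exp θ - 1 ≤ 2 * θ := by
      have := Real.abs_exp_sub_one_le (x := θ) (by rw [abs_of_pos hθ]; exact hθ1)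
      rw [abs_of_pos hθ] at this
      exact (le_abs_self _).trans this
    calc _ ≤ (Real.exp (2 * θ / k)) ^ a := by
          refine pow_le_pow_left₀ (by have := Real.exp_pos θ; nlinarith [mul_nonneg hq0 this.le]) ?_ a
          refine le_trans ?_ (Real.add_one_le_exp _)
          have : 1 / k * (Real.exp θ - 1) ≤ 1 / k * (2 * θ) := by gcongr
          have e : 2 * θ / k = 1 / k * (2 * θ) := by ring
          rw [e]; linarith
      _ = Real.exp (a * (2 * θ / k)) := by rw [Real.exp_nat_mul]
      _ ≤ _ := by
          rw [Real.exp_le_exp]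
          calc (a : ℝ) * (2 * θ / k) ≤ M * (2 * θ / k) := by gcongr
            _ = _ := by ring
  have hcard : (J.card : ℝ) ≤ M := by
    refine le_trans ?_ ha
    have : J.card ≤ (Finset.Icc 2 a).card := Finset.card_filter_le _ _
    rw [Nat.card_Icc] at this
    exact_mod_cast (by omega : J.card ≤ a)
  have hsum : ∑ i ∈ J, Real.exp (l * (i.choose 2 : ℕ)) * ((a.choose i : ℝ) * (1 / k) ^ i)
      ≤ M * Real.exp (-(3 / 2) * L) := by
    refine (Finset.sum_le_card_nsmul _ _ _ hterm).trans ?_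
    rw [nsmul_eq_mul]
    gcongr
  have hA0 : 0 ≤ 2 * θ * M / k := by positivity
  have hB0 : 0 ≤ M * Real.exp (-(3 / 2) * L) := by positivity
  calc _ ≤ Real.exp (2 * θ * M / k) + M * Real.exp (-(3 / 2) * L) := by linarith
    _ ≤ Real.exp (2 * θ * M / k) * (M * Real.exp (-(3 / 2) * L) + 1) := by
        have := Real.one_le_exp hA0
        nlinarith
    _ ≤ Real.exp (2 * θ * M / k) * Real.exp (M * Real.exp (-(3 / 2) * L)) := by
        gcongr; exact Real.add_one_le_exp _
    _ = _ := by rw [Real.exp_add]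

end OverlapBound

section Balanced

theorem card_unbalanced_le {n k : ℕ} [NeZero k] {η : ℝ} (hη : 0 ≤ η) (hη1 : η ≤ 1) (i : Fin k) :
    ((Finset.univ.filter fun σ : Fin n → Fin k => (1 + η) * (n / k) <
        ((Finset.univ.filter fun v => σ v = i).card : ℝ)).card : ℝ)
      ≤ (k : ℝ) ^ n * Real.exp (-(n / k * η ^ 2 / 4)) := by
  classical
  have hk : (0 : ℝ) < k := by exact_mod_cast Nat.pos_of_ne_zero (NeZero.ne k)
  set m : ℝ := n / k with hm
  have hm0 : 0 ≤ m := by positivity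
  set u : ℝ := η / 2 with hu
  have hu0 : 0 ≤ u := by positivity
  have hmgf : ∑ σ : Fin n → Fin k, Real.exp (u * ((Finset.univ.filter fun v => σ v = i).card : ℝ))
      ≤ (k : ℝ) ^ n * Real.exp (m * (Real.exp u - 1)) := by
    have h1 : ∀ σ : Fin n → Fin k,
        Real.exp (u * ((Finset.univ.filter fun v => σ v = i).card : ℝ))
          = ∏ v, if σ v = i then Real.exp u else 1 := by
      intro σ
      rw [Finset.prod_ite, Finset.prod_const, Finset.prod_const_one, mul_one, mul_comm,
        Real.exp_nat_mul]
    simp only [h1]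
    rw [← Fintype.sum_pow (fun j : Fin k => if j = i then Real.exp u else 1) n]
    have h2 : ∑ j : Fin k, (if j = i then Real.exp u else (1 : ℝ))
        = k * (1 + (Real.exp u - 1) / k) := by
      have : ∀ j : Fin k, (if j = i then Real.exp u else (1 : ℝ))
          = 1 + if j = i then Real.exp u - 1 else 0 := fun j => by split_ifs <;> ring
      simp only [this, Finset.sum_add_distrib, Finset.sum_ite_eq', Finset.mem_univ, if_true]
      field_simp
      simp
    rw [h2, mul_pow]
    refine mul_le_mul_of_nonneg_left ?_ (by positivity)
    have h3 : 0 ≤ (Real.exp u - 1) / k :=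
      div_nonneg (by linarith [Real.one_le_exp hu0]) hk.le
    calc _ ≤ (Real.exp ((Real.exp u - 1) / k)) ^ n := by
          refine pow_le_pow_left₀ (by linarith) ?_ n
          linarith [Real.add_one_le_exp ((Real.exp u - 1) / k)]
      _ = _ := by
          rw [← Real.exp_nat_mul, hm]; congr 1; ring
  set bad := Finset.univ.filter fun σ : Fin n → Fin k => (1 + η) * m <
        ((Finset.univ.filter fun v => σ v = i).card : ℝ) with hbad
  have hmark : (bad.card : ℝ) * Real.exp (u * ((1 + η) * m))
      ≤ ∑ σ : Fin n → Fin k, Real.exp (u * ((Finset.univ.filter fun v => σ v = i).card : ℝ)) := by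
    rw [← nsmul_eq_mul]
    refine (Finset.card_nsmul_le_sum bad _ _ fun σ hσ => ?_).trans
      (Finset.sum_le_sum_of_subset_of_nonneg (Finset.subset_univ bad)
        fun σ _ _ => (Real.exp_pos _).le)
    rw [Real.exp_le_exp]
    exact mul_le_mul_of_nonneg_left (Finset.mem_filter.1 hσ).2.le hu0
  have hexp : Real.exp u - 1 ≤ u + u ^ 2 := by
    have := Real.abs_exp_sub_one_sub_id_le (x := u) (by rw [abs_of_nonneg hu0]; linarith)
    linarith [le_abs_self (Real.exp u - 1 - u)]
  have h := hmark.trans hmgf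
  rw [← le_div_iff₀ (Real.exp_pos _), mul_div_assoc, ← Real.exp_sub] at h
  refine h.trans ?_
  gcongr
  have : m * (Real.exp u - 1) ≤ m * (u + u ^ 2) := by gcongr
  refine (sub_le_sub_right this _).trans (le_of_eq ?_)
  rw [hu]; ring

theorem card_balanced_ge {n k : ℕ} [NeZero k] {η : ℝ} (hη : 0 ≤ η) (hη1 : η ≤ 1)
    (h : (k : ℝ) * Real.exp (-(n / k * η ^ 2 / 4)) ≤ 1 / 2) :
    (k : ℝ) ^ n / 2 ≤ ((Finset.univ.filter fun σ : Fin n → Fin k =>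
      ∀ i, ((Finset.univ.filter fun v => σ v = i).card : ℝ) ≤ (1 + η) * (n / k)).card : ℝ) := by
  classical
  have hsplit := Finset.card_filter_add_card_filter_not (s := Finset.univ)
    (fun σ : Fin n → Fin k =>
      ∀ i, ((Finset.univ.filter fun v => σ v = i).card : ℝ) ≤ (1 + η) * (n / k))
  have hbad : ((Finset.univ.filter fun σ : Fin n → Fin k =>
      ¬ ∀ i, ((Finset.univ.filter fun v => σ v = i).card : ℝ) ≤ (1 + η) * (n / k)).card : ℝ)
      ≤ (k : ℝ) ^ n / 2 := by
    calc _ ≤ (((Finset.univ : Finset (Fin k)).biUnion fun i =>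
          Finset.univ.filter fun σ : Fin n → Fin k => (1 + η) * (n / k) <
            ((Finset.univ.filter fun v => σ v = i).card : ℝ)).card : ℝ) := by
          refine Nat.cast_le.2 (Finset.card_le_card fun σ hσ => ?_)
          simpa using hσ
      _ ≤ ∑ i : Fin k, (k : ℝ) ^ n * Real.exp (-(n / k * η ^ 2 / 4)) := by
          refine (Nat.cast_le.2 Finset.card_biUnion_le).trans ?_
          rw [Nat.cast_sum]
          exact Finset.sum_le_sum fun i _ => card_unbalanced_le hη hη1 i
      _ = (k : ℝ) ^ n * (k * Real.exp (-(n / k * η ^ 2 / 4))) := by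
          simp; ring
      _ ≤ _ := by
          have : (0 : ℝ) ≤ (k : ℝ) ^ n := by positivity
          nlinarith
  rw [Finset.card_univ, Fintype.card_fun, Fintype.card_fin, Fintype.card_fin] at hsplit
  have : ((_ : ℕ) : ℝ) = _ := congrArg (Nat.cast (R := ℝ)) hsplit
  push_cast at this
  linarith

end Balanced

section Deletion

variable {n : ℕ}

/-- `σ` is a proper colouring after deleting the vertices in `W`. -/
def ProperOff {k : ℕ} (f : Sym2 (Fin n) → Bool) (W : Finset (Fin n)) (σ : Fin n → Fin k) : Prop :=
  ∀ u v, u ∉ W → v ∉ W → u ≠ v → σ u = σ v → f s(u, v) = false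

/-- The least number of vertices whose deletion leaves a properly `k`-colourable graph. -/
noncomputable def deletionNumber (k : ℕ) (f : Sym2 (Fin n) → Bool) : ℕ :=
  sInf {s | ∃ W : Finset (Fin n), W.card = s ∧ ∃ σ : Fin n → Fin k, ProperOff f W σ}

theorem exists_properOff (k : ℕ) [NeZero k] (f : Sym2 (Fin n) → Bool) :
    ∃ W : Finset (Fin n), W.card = deletionNumber k f ∧ ∃ σ : Fin n → Fin k, ProperOff f W σ :=
  Nat.sInf_mem (s := {s | ∃ W : Finset (Fin n), W.card = s ∧
    ∃ σ : Fin n → Fin k, ProperOff f W σ})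
    ⟨_, Finset.univ, rfl, fun _ => 0, fun u _ hu => absurd (Finset.mem_univ u) hu⟩

theorem deletionNumber_le {k : ℕ} {f : Sym2 (Fin n) → Bool} {W : Finset (Fin n)}
    {σ : Fin n → Fin k} (h : ProperOff f W σ) : deletionNumber k f ≤ W.card :=
  Nat.sInf_le ⟨W, rfl, σ, h⟩

theorem deletionNumber_le_add_one (k : ℕ) [NeZero k] (f g : Sym2 (Fin n) → Bool) (v : Fin n)
    (h : ∀ e : Sym2 (Fin n), v ∉ e → f e = g e) :
    deletionNumber k f ≤ deletionNumber k g + 1 := by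
  obtain ⟨W, hW, σ, hσ⟩ := exists_properOff k g
  have : ProperOff f (insert v W) σ := by
    intro a b ha hb hab hs
    rw [Finset.mem_insert, not_or] at ha hb
    rw [h _ (by simp [Ne.symm ha.1, Ne.symm hb.1])]
    exact hσ a b ha.2 hb.2 hab hs
  refine (deletionNumber_le this).trans ?_
  rw [← hW]
  exact Finset.card_insert_le _ _

theorem bernoulliPr_le_deletionNumber {k : ℕ} [NeZero k] {p : ℝ} (h0 : 0 ≤ p) (h1 : p ≤ 1)
    (hn : 0 < n) {r : ℝ} (hr : 0 < r)
    (hcol : Real.exp (-(r ^ 2 / (2 * n))) ≤ bernoulliPr p (fun f : Sym2 (Fin n) → Bool =>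
        ∃ σ : Fin n → Fin k, ∀ e ∈ monoPairs σ, f e = false)) :
    bernoulliPr p (fun f : Sym2 (Fin n) → Bool => 2 * r ≤ (deletionNumber k f : ℝ))
      ≤ Real.exp (-(r ^ 2 / (2 * n))) := by
  have hn' : (0 : ℝ) < n := by exact_mod_cast hn
  set Y : (Sym2 (Fin n) → Bool) → ℝ := fun f => deletionNumber k f with hY
  set μ := wexp (bernoulliWeight p) Y with hμ
  have hmgf := fun s => wexp_exp_sub_mean_le_of_vertex h0 h1 s Y
    (fun f g v h => by
      simp only [hY]
      exact_mod_cast deletionNumber_le_add_one k f g v h)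
  have hμr : μ ≤ r := by
    have h2 := mul_bernoulliPr_le (ι := Sym2 (Fin n)) h0 h1
      (F := fun f => Real.exp (-(r / n) * (Y f - μ)))
      (fun f => (Real.exp_pos _).le) (a := Real.exp (r / n * μ))
      (Q := fun f => ∃ σ : Fin n → Fin k, ∀ e ∈ monoPairs σ, f e = false) (by
        rintro f ⟨σ, hσ⟩
        have : deletionNumber k f = 0 := by
          have h := deletionNumber_le (f := f) (W := ∅) (σ := σ)
            (fun u v _ _ huv hs => hσ _ (mk_mem_monoPairs.2 ⟨huv, hs⟩))
          simpa using h
        simp [hY, this])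
    have h3 := (mul_le_mul_of_nonneg_left hcol (Real.exp_pos (r / n * μ)).le).trans
      (h2.trans (hmgf (-(r / n))))
    rw [← Real.exp_add, Real.exp_le_exp] at h3
    have e : (-(r / n)) ^ 2 / 2 * n = r / n * (r / 2) := by field_simp
    have e' : r ^ 2 / (2 * n) = r / n * (r / 2) := by field_simp
    rw [e, e'] at h3
    have : r / n * μ ≤ r / n * r := by linarith
    exact le_of_mul_le_mul_left this (by positivity)
  have h2 := mul_bernoulliPr_le (ι := Sym2 (Fin n)) h0 h1
    (F := fun f => Real.exp (r / n * (Y f - μ)))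
    (fun f => (Real.exp_pos _).le) (a := Real.exp (r / n * r))
    (Q := fun f => 2 * r ≤ (deletionNumber k f : ℝ)) (by
      intro f hf
      rw [Real.exp_le_exp]
      have : r ≤ Y f - μ := by simp only [hY]; linarith
      gcongr)
  have h3 := h2.trans (hmgf (r / n))
  rw [mul_comm, ← le_div_iff₀ (Real.exp_pos _), ← Real.exp_sub] at h3
  refine h3.trans (le_of_eq ?_)
  congr 1
  field_simp
  ring

end Deletion

section Sparse

variable {n : ℕ}

/-- The unordered pairs of distinct elements of `S`. -/
def pairsIn (S : Finset (Fin n)) : Finset (Sym2 (Fin n)) :=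
  S.offDiag.image (Function.uncurry Sym2.mk)

theorem mk_mem_pairsIn {S : Finset (Fin n)} {u v : Fin n} :
    s(u, v) ∈ pairsIn S ↔ u ∈ S ∧ v ∈ S ∧ u ≠ v := by
  simp only [pairsIn, Finset.mem_image, Finset.mem_offDiag, Prod.exists, Function.uncurry_apply_pair,
    Sym2.eq_iff]
  constructor
  · rintro ⟨a, b, ⟨ha, hb, hab⟩, ⟨rfl, rfl⟩ | ⟨rfl, rfl⟩⟩
    · exact ⟨ha, hb, hab⟩
    · exact ⟨hb, ha, hab.symm⟩
  · rintro h
    exact ⟨u, v, h, Or.inl ⟨rfl, rfl⟩⟩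

theorem card_pairsIn (S : Finset (Fin n)) : (pairsIn S).card = S.card.choose 2 :=
  Sym2.card_image_offDiag S

theorem sum_card_neighbours_eq (f : Sym2 (Fin n) → Bool) (S : Finset (Fin n)) :
    ∑ v ∈ S, (S.filter fun u => v ≠ u ∧ f s(v, u) = true).card
      = 2 * ((pairsIn S).filter fun e => f e = true).card := by
  classical
  set E := (pairsIn S).filter fun e => f e = true with hE
  set H : SimpleGraph (Fin n) := SimpleGraph.fromEdgeSet (E : Set (Sym2 (Fin n))) with hH
  have hadj : ∀ u v, H.Adj u v ↔ (u ∈ S ∧ v ∈ S ∧ u ≠ v) ∧ f s(u, v) = true := by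
    intro u v
    simp only [hH, SimpleGraph.fromEdgeSet_adj, hE, Finset.mem_coe, Finset.mem_filter,
      mk_mem_pairsIn]
    tauto
  have hedge : ∀ _ : Fintype H.edgeSet, H.edgeFinset = E := by
    intro _
    ext e
    induction e using Sym2.inductionOn with
    | hf u v =>
      rw [SimpleGraph.mem_edgeFinset, SimpleGraph.mem_edgeSet, hadj, hE, Finset.mem_filter,
        mk_mem_pairsIn]
  have hdeg : ∑ v, H.degree v = 2 * E.card := by
    exact H.sum_degrees_eq_twice_card_edges.trans (congrArg (fun A => 2 * Finset.card A) (hedge _))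
  rw [← hdeg]
  refine Eq.trans ?_ (Finset.sum_subset (Finset.subset_univ S) fun v _ hv => ?_)
  · refine Finset.sum_congr rfl fun v hv => ?_
    rw [← SimpleGraph.card_neighborFinset_eq_degree]
    congr 1
    ext u
    simp only [Finset.mem_filter, SimpleGraph.mem_neighborFinset, hadj]
    tauto
  · rw [← SimpleGraph.card_neighborFinset_eq_degree, Finset.card_eq_zero,
      Finset.eq_empty_iff_forall_notMem]
    intro u
    rw [SimpleGraph.mem_neighborFinset, hadj]
    tauto

theorem exists_colouring_of_degenerate (f : Sym2 (Fin n) → Bool) (D : ℕ) (hD : 0 < D)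
    (W : Finset (Fin n))
    (h : ∀ S ⊆ W, S.Nonempty →
      ∃ v ∈ S, (S.filter fun u => v ≠ u ∧ f s(v, u) = true).card < D) :
    ∃ σ : Fin n → Fin D, ∀ u ∈ W, ∀ v ∈ W, u ≠ v → σ u = σ v → f s(u, v) = false := by
  classical
  induction W using Finset.strongInduction with
  | H W ih =>
    rcases W.eq_empty_or_nonempty with rfl | hW
    · exact ⟨fun _ => ⟨0, hD⟩, by simp⟩
    obtain ⟨v, hv, hcard⟩ := h W subset_rfl hW
    obtain ⟨σ, hσ⟩ := ih (W.erase v) (Finset.erase_ssubset hv) fun S hS =>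
      h S (hS.trans (Finset.erase_subset _ _))
    obtain ⟨c, hc⟩ : ∃ c, c ∉ (W.filter fun u => v ≠ u ∧ f s(v, u) = true).image σ := by
      by_contra hc
      push Not at hc
      have := Finset.card_le_card (show (Finset.univ : Finset (Fin D)) ⊆ _ from fun c _ => hc c)
      rw [Finset.card_univ, Fintype.card_fin] at this
      exact absurd (this.trans Finset.card_image_le) (not_le.2 hcard)
    have hfree : ∀ u ∈ W, v ≠ u → σ u = c → f s(v, u) = false := by
      intro u hu huv hs
      by_contra hf
      rw [Bool.not_eq_false] at hf
      exact hc (Finset.mem_image.2 ⟨u, Finset.mem_filter.2 ⟨hu, huv, hf⟩, hs⟩)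
    refine ⟨Function.update σ v c, fun a ha b hb hab hs => ?_⟩
    by_cases hav : a = v
    · subst hav
      rw [Function.update_self, Function.update_of_ne hab.symm] at hs
      exact hfree b hb hab hs.symm
    · by_cases hbv : b = v
      · subst hbv
        rw [Function.update_self, Function.update_of_ne hab] at hs
        rw [Sym2.eq_swap]
        exact hfree a ha hab.symm hs
      · rw [Function.update_of_ne hav, Function.update_of_ne hbv] at hs
        exact hσ a (Finset.mem_erase.2 ⟨hav, ha⟩) b (Finset.mem_erase.2 ⟨hbv, hb⟩) hab hs

theorem sum_range_mul_half_pow_le (N : ℕ) :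
    ∑ s ∈ Finset.range N, (s : ℝ) * (1 / 2) ^ s ≤ 2 := by
  have h : ∑ s ∈ Finset.range N, (s : ℝ) * (1 / 2) ^ s = 2 - 2 * (N + 1) * (1 / 2) ^ N := by
    induction N with
    | zero => simp
    | succ N ih => rw [Finset.sum_range_succ, ih]; push_cast; ring
  rw [h]
  have : 0 ≤ 2 * ((N : ℝ) + 1) * (1 / 2) ^ N := by positivity
  linarith

theorem dense_term_le {s q : ℕ} {p x : ℝ} (hp : 0 < p) (hn : 0 < n) (hq : 2 ≤ q) (hs : 0 < s)
    (hsn : s ≤ n) (hsx : (s : ℝ) ≤ x) (hx : x * p / (2 * q) ≤ Real.exp (-2))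
    (hq2 : 5 + Real.log 2 + 2 * Real.log (n * p / (2 * q)) ≤ q) :
    (n.choose s : ℝ) * ((s.choose 2).choose (q * s) * p ^ (q * s))
      ≤ 1 / n * (s * (1 / 2) ^ s) := by
  have hn' : (0 : ℝ) < n := by exact_mod_cast hn
  have hs' : (0 : ℝ) < s := by exact_mod_cast hs
  have hq' : (2 : ℝ) ≤ q := by exact_mod_cast hq
  have hq0 : (0 : ℝ) < q := by linarith
  have h1 := choose_le_exp (a := n) hs le_rfl hn'
  have h2 := choose_le_exp (a := s.choose 2) (j := q * s) (M := (s : ℝ) ^ 2 / 2)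
    (Nat.mul_pos (by omega) hs) (by rw [Nat.cast_choose_two]; nlinarith) (by positivity)
  have h3 : p ^ (q * s) = Real.exp ((q * s : ℕ) * Real.log p) := by
    rw [Real.exp_nat_mul, Real.exp_log hp]
  set y : ℝ := Real.log (s * p / (2 * q)) with hy
  have hy1 : y ≤ -2 := by
    rw [hy, Real.log_le_iff_le_exp (by positivity)]
    refine le_trans ?_ hx
    gcongr
  have e1 : Real.log ((s : ℝ) ^ 2 / 2 / ((q * s : ℕ) : ℝ)) + Real.log p = y := by
    rw [← Real.log_mul (by positivity) hp.ne', hy]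
    congr 1
    push_cast
    field_simp
  have e2 : y = Real.log (s / n) + Real.log (n * p / (2 * q)) := by
    rw [← Real.log_mul (by positivity) (by positivity), hy]
    congr 1
    field_simp
  have e3 : Real.log ((n : ℝ) / s) = - Real.log (s / n) := by
    rw [← Real.log_inv, inv_div]
  calc _ ≤ Real.exp (s * (1 + Real.log (n / s))) *
        (Real.exp ((q * s : ℕ) * (1 + Real.log ((s : ℝ) ^ 2 / 2 / ((q * s : ℕ) : ℝ)))) *
          Real.exp ((q * s : ℕ) * Real.log p)) := by
        rw [← h3]; gcongr
    _ = Real.exp (s * (1 - Real.log (s / n) + q * (1 + y))) := by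
        rw [← Real.exp_add, ← Real.exp_add, ← e1, e3]
        congr 1
        push_cast
        ring
    _ ≤ Real.exp (s * (Real.log (s / n) - Real.log 2)) := by
        rw [Real.exp_le_exp]
        refine mul_le_mul_of_nonneg_left ?_ hs'.le
        nlinarith
    _ = (s / n : ℝ) ^ s * (1 / 2) ^ s := by
        rw [← Real.log_div (by positivity) (by norm_num), Real.exp_nat_mul,
          Real.exp_log (by positivity), ← mul_pow]
        congr 1; ring
    _ ≤ (s / n : ℝ) * (1 / 2) ^ s := by
        gcongr
        refine pow_le_of_le_one (by positivity) ?_ (by omega)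
        rw [div_le_one hn']; exact_mod_cast hsn
    _ = _ := by ring

theorem bernoulliPr_exists_dense_le {q : ℕ} {p x : ℝ} (hp : 0 < p) (hp1 : p ≤ 1) (hn : 0 < n)
    (hq : 2 ≤ q) (hx : x * p / (2 * q) ≤ Real.exp (-2))
    (hq2 : 5 + Real.log 2 + 2 * Real.log (n * p / (2 * q)) ≤ q) :
    bernoulliPr p (fun f : Sym2 (Fin n) → Bool => ∃ S : Finset (Fin n), S.Nonempty ∧
      (S.card : ℝ) ≤ x ∧ q * S.card ≤ ((pairsIn S).filter fun e => f e = true).card)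
      ≤ 2 / n := by
  classical
  have hn' : (0 : ℝ) < n := by exact_mod_cast hn
  set c : ℕ → ℝ := fun s => if 0 < s ∧ (s : ℝ) ≤ x then
    ((s.choose 2).choose (q * s) * p ^ (q * s) : ℝ) else 0 with hc
  calc _ ≤ bernoulliPr p (fun f : Sym2 (Fin n) → Bool =>
        ∃ S ∈ (Finset.univ : Finset (Fin n)).powerset, (0 < S.card ∧ (S.card : ℝ) ≤ x) ∧
          q * S.card ≤ ((pairsIn S).filter fun e => f e = true).card) := by
        refine bernoulliPr_mono hp.le hp1 ?_
        rintro f ⟨S, hS, hSx, h⟩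
        exact ⟨S, by simp, ⟨hS.card_pos, hSx⟩, h⟩
    _ ≤ ∑ S ∈ (Finset.univ : Finset (Fin n)).powerset, c S.card := by
        refine (bernoulliPr_exists_le hp.le hp1 _ _).trans (Finset.sum_le_sum fun S _ => ?_)
        by_cases h : 0 < S.card ∧ (S.card : ℝ) ≤ x
        · simp only [hc, if_pos h]
          rw [← card_pairsIn]
          refine le_trans ?_ (bernoulliPr_le_card_filter_le hp.le hp1 (pairsIn S) (q * S.card))
          exact bernoulliPr_mono hp.le hp1 fun f hf => hf.2
        · simp only [hc, if_neg h]
          unfold bernoulliPr wexp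
          refine (Finset.sum_eq_zero fun f _ => ?_).le
          beta_reduce
          rw [if_neg fun hf => h hf.1, mul_zero]
    _ = ∑ s ∈ Finset.range (n + 1), n.choose s • c s := by
        rw [Finset.sum_powerset_apply_card, Finset.card_univ, Fintype.card_fin]
    _ ≤ ∑ s ∈ Finset.range (n + 1), 1 / n * (s * (1 / 2) ^ s : ℝ) := by
        refine Finset.sum_le_sum fun s hs => ?_
        rw [Finset.mem_range] at hs
        rw [nsmul_eq_mul]
        by_cases h : 0 < s ∧ (s : ℝ) ≤ x
        · simp only [hc, if_pos h]
          exact dense_term_le hp hn hq h.1 (by omega) h.2 hx hq2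
        · simp only [hc, if_neg h, mul_zero]
          positivity
    _ ≤ _ := by
        rw [← Finset.mul_sum]
        have := sum_range_mul_half_pow_le (n + 1)
        calc _ ≤ 1 / (n : ℝ) * 2 := by gcongr
          _ = _ := by ring

end Sparse

section Deterministic

variable {n : ℕ}

theorem improperChromaticNumber_le_of_proper {k : ℕ} (f : Sym2 (Fin n) → Bool) (t : ℕ)
    {σ : Fin n → Fin k} (h : ProperOff f ∅ σ) :
    improperChromaticNumber (SimpleGraph.fromEdgeSet {e | f e = true}) t ≤ k := by
  refine Nat.sInf_le ⟨σ, fun i v hv => ?_⟩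
  have : {u ∈ {v | σ v = i} | (SimpleGraph.fromEdgeSet {e | f e = true}).Adj v u} = ∅ := by
    ext u
    simp only [Set.mem_ofPred_eq, SimpleGraph.fromEdgeSet_adj, Set.mem_empty_iff_false, iff_false]
    rintro ⟨hu, hf, huv⟩
    have := h v u (by simp) (by simp) huv (by rw [hu]; exact hv)
    rw [this] at hf
    exact absurd hf (by simp)
  rw [this, Set.ncard_empty]
  exact Nat.zero_le t

theorem improperChromaticNumber_le_add {k q : ℕ} [NeZero k] (hq : 0 < q)
    (f : Sym2 (Fin n) → Bool) (t : ℕ)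
    (h : ∀ S : Finset (Fin n), S.Nonempty → S.card ≤ deletionNumber k f →
      ((pairsIn S).filter fun e => f e = true).card < q * S.card) :
    improperChromaticNumber (SimpleGraph.fromEdgeSet {e | f e = true}) t ≤ k + 2 * q := by
  classical
  obtain ⟨W, hW, σ, hσ⟩ := exists_properOff k f
  obtain ⟨ρ, hρ⟩ := exists_colouring_of_degenerate f (2 * q) (by omega) W (by
    intro S hS hne
    by_contra hc
    push Not at hc
    have h1 := Finset.card_nsmul_le_sum S _ _ hc
    rw [sum_card_neighbours_eq, smul_eq_mul] at h1
    have h2 := h S hne ((Finset.card_le_card hS).trans hW.le)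
    nlinarith)
  refine improperChromaticNumber_le_of_proper f t
    (σ := fun v => if v ∈ W then Fin.natAdd k (ρ v) else Fin.castAdd (2 * q) (σ v)) ?_
  intro u v _ _ huv hs
  have hne : ∀ (a : Fin k) (b : Fin (2 * q)), Fin.castAdd (2 * q) a ≠ Fin.natAdd k b := by
    intro a b hab
    have := congrArg Fin.val hab
    simp only [Fin.val_castAdd, Fin.val_natAdd] at this
    omega
  by_cases hu : u ∈ W <;> by_cases hv : v ∈ W <;> simp only [hu, hv, if_true, if_false] at hs
  · exact hρ u hu v hv huv (Fin.natAdd_injective _ _ hs)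
  · exact absurd hs.symm (hne _ _)
  · exact absurd hs (hne _ _)
  · exact hσ u v hu hv huv (Fin.castAdd_injective _ _ hs)

theorem exists_improperColouring {V : Type*} [Fintype V] (G : SimpleGraph V) (t : ℕ) :
    ∃ c : V → Fin (improperChromaticNumber G t), ∀ i, IsTDependent G t {v | c v = i} := by
  refine Nat.sInf_mem (s := {k | ∃ c : V → Fin k, ∀ i : Fin k, IsTDependent G t {v | c v = i}})
    ⟨Fintype.card V, Fintype.equivFin V, fun i v hv => ?_⟩
  have : {u ∈ {v | Fintype.equivFin V v = i} | G.Adj v u} = ∅ := by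
    ext u
    simp only [Set.mem_ofPred_eq, Set.mem_empty_iff_false, iff_false]
    rintro ⟨hu, huv⟩
    exact huv.ne ((Fintype.equivFin V).injective (Eq.trans hv hu.symm))
  rw [this, Set.ncard_empty]
  exact Nat.zero_le t

theorem exists_sparse_of_improperChromaticNumber_mul_lt (f : Sym2 (Fin n) → Bool) {t m : ℕ}
    (h : improperChromaticNumber (SimpleGraph.fromEdgeSet {e | f e = true}) t * m < n) :
    ∃ S : Finset (Fin n), S.card = m + 1 ∧
      2 * ((pairsIn S).filter fun e => f e = true).card ≤ t * (m + 1) := by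
  classical
  obtain ⟨c, hc⟩ := exists_improperColouring (SimpleGraph.fromEdgeSet {e | f e = true}) t
  obtain ⟨i, -, hi⟩ := Finset.exists_lt_card_fiber_of_mul_lt_card_of_maps_to
    (s := (Finset.univ : Finset (Fin n))) (t := Finset.univ) (f := c) (n := m)
    (fun _ _ => Finset.mem_univ _) (by simpa using h)
  obtain ⟨S, hS, hcard⟩ := Finset.exists_subset_card_eq (n := m + 1) (Nat.succ_le_of_lt hi)
  refine ⟨S, hcard, ?_⟩
  rw [← sum_card_neighbours_eq, ← hcard, mul_comm, ← smul_eq_mul]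
  refine Finset.sum_le_card_nsmul _ _ _ fun v hv => ?_
  have hv' : c v = i := (Finset.mem_filter.1 (hS hv)).2
  refine le_trans ?_ (hc i v hv')
  rw [← Set.ncard_coe_finset]
  refine Set.ncard_le_ncard (fun u hu => ?_) (Set.toFinite _)
  simp only [Finset.coe_filter, Set.mem_ofPred_eq] at hu
  exact ⟨(Finset.mem_filter.1 (hS hu.1)).2, by
    rw [SimpleGraph.fromEdgeSet_adj]; exact ⟨hu.2.2, hu.2.1⟩⟩

theorem bernoulliPr_exists_sparse_le {p : ℝ} (h0 : 0 ≤ p) (h1 : p ≤ 1) {u : ℝ} (hu : 0 ≤ u)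
    (t K : ℕ) :
    bernoulliPr p (fun f : Sym2 (Fin n) → Bool => ∃ S : Finset (Fin n), S.card = K ∧
      2 * ((pairsIn S).filter fun e => f e = true).card ≤ t * K)
      ≤ n.choose K * Real.exp (u * (t * K / 2) - p * (1 - Real.exp (-u)) * (K * (K - 1) / 2)) := by
  classical
  calc _ ≤ bernoulliPr p (fun f : Sym2 (Fin n) → Bool =>
        ∃ S ∈ (Finset.univ : Finset (Fin n)).powersetCard K,
          (((pairsIn S).filter fun e => f e = true).card : ℝ) ≤ t * K / 2) := by
        refine bernoulliPr_mono h0 h1 ?_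
        rintro f ⟨S, hS, h⟩
        refine ⟨S, Finset.mem_powersetCard.2 ⟨Finset.subset_univ S, hS⟩, ?_⟩
        have : ((2 * ((pairsIn S).filter fun e => f e = true).card : ℕ) : ℝ) ≤ (t * K : ℕ) :=
          Nat.cast_le.2 h
        push_cast at this
        linarith
    _ ≤ _ := by
        refine (bernoulliPr_exists_le h0 h1 _ _).trans ?_
        have hb : ∀ S ∈ (Finset.univ : Finset (Fin n)).powersetCard K,
            bernoulliPr p (fun f : Sym2 (Fin n) → Bool =>
              (((pairsIn S).filter fun e => f e = true).card : ℝ) ≤ t * K / 2)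
            ≤ Real.exp (u * (t * K / 2) - p * (1 - Real.exp (-u)) * (K * (K - 1) / 2)) := by
          intro S hS
          have := bernoulliPr_card_filter_le h0 h1 (pairsIn S) hu (t * K / 2)
          rwa [card_pairsIn, (Finset.mem_powersetCard.1 hS).2, Nat.cast_choose_two] at this
        refine (Finset.sum_le_card_nsmul _ _ _ hb).trans (le_of_eq ?_)
        rw [nsmul_eq_mul, Finset.card_powersetCard, Finset.card_univ, Fintype.card_fin]

/-- Lower tail of the improper chromatic number. -/
theorem bernoulliPr_improperChromaticNumber_lt_le {ε p : ℝ} (hε : 0 < ε) (hε1 : ε ≤ 1 / 4)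
    (hp : 0 < p) (hp1 : p ≤ 1) (hn : 0 < n) (hL : 6 / ε ≤ Real.log (n * p)) {t : ℕ}
    (ht : (t : ℝ) ≤ ε / (2 * Real.log (4 / ε)) * Real.log (n * p)) :
    bernoulliPr p (fun f : Sym2 (Fin n) → Bool =>
      (improperChromaticNumber (SimpleGraph.fromEdgeSet {e | f e = true}) t : ℝ)
        < (1 - ε) * (n * p) / (2 * Real.log (n * p))) ≤ Real.exp (-(1 / p)) := by
  have hn' : (0 : ℝ) < n := by exact_mod_cast hn
  set L := Real.log (n * p) with hLdef
  have hL6 : 6 ≤ ε * L := by rw [div_le_iff₀ hε] at hL; linarith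
  have hL1 : 1 ≤ L := by nlinarith
  have hL0 : 0 < L := by linarith
  have hε' : 0 < 1 - ε := by linarith
  set u := Real.log (4 / ε) with hu
  have hu0 : 0 < u := Real.log_pos (by rw [lt_div_iff₀ hε]; linarith)
  have heu : Real.exp (-u) = ε / 4 := by
    rw [hu, ← Real.log_inv, Real.exp_log (by positivity), inv_div]
  set z := 2 * L / ((1 - ε) * p) with hz
  have hz0 : 0 < z := by positivity
  set m := ⌊z⌋₊ with hm
  have hmz : (m : ℝ) ≤ z := Nat.floor_le hz0.le
  have hzm : z < m + 1 := Nat.lt_floor_add_one z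
  have hK : (0 : ℝ) < m + 1 := by positivity
  have hpm : 2 * (L / (1 - ε)) ≤ p * (m + 1) := by
    have hzp : p * z = 2 * (L / (1 - ε)) := by rw [hz]; field_simp
    rw [← hzp]
    gcongr
  have hdiv : (1 + 3 / 4 * ε) * L ≤ (1 - ε / 4) * (L / (1 - ε)) := by
    rw [← mul_div_assoc, le_div_iff₀ hε']
    nlinarith [mul_pos (mul_pos hε hε) hL0]
  have hL1ε : L ≤ L / (1 - ε) := by
    rw [le_div_iff₀ hε']; nlinarith
  calc _ ≤ bernoulliPr p (fun f : Sym2 (Fin n) → Bool => ∃ S : Finset (Fin n),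
        S.card = m + 1 ∧ 2 * ((pairsIn S).filter fun e => f e = true).card ≤ t * (m + 1)) := by
        refine bernoulliPr_mono hp.le hp1 fun f hf =>
          exists_sparse_of_improperChromaticNumber_mul_lt f ?_
        rw [← Nat.cast_lt (α := ℝ), Nat.cast_mul]
        calc _ ≤ (improperChromaticNumber (SimpleGraph.fromEdgeSet {e | f e = true}) t : ℝ) * z := by
              gcongr
          _ < (1 - ε) * (n * p) / (2 * L) * z := by gcongr
          _ = n := by rw [hz]; field_simp
    _ ≤ _ := bernoulliPr_exists_sparse_le hp.le hp1 hu0.le t (m + 1)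
    _ ≤ Real.exp ((m + 1 : ℕ) * (1 + Real.log (n / (m + 1 : ℕ)))) *
        Real.exp (u * (t * (m + 1 : ℕ) / 2) -
          p * (1 - Real.exp (-u)) * ((m + 1 : ℕ) * ((m + 1 : ℕ) - 1) / 2)) := by
        gcongr
        exact choose_le_exp (by omega) le_rfl hn'
    _ = Real.exp ((m + 1 : ℝ) * (1 + Real.log (n / (m + 1 : ℝ)) + u * t / 2
          - (1 - ε / 4) * (p * m / 2))) := by
        rw [← Real.exp_add, heu]
        congr 1
        push_cast
        ring
    _ ≤ Real.exp ((m + 1 : ℝ) * (-1)) := by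
        rw [Real.exp_le_exp]
        refine mul_le_mul_of_nonneg_left ?_ hK.le
        have h1 : Real.log (n / (m + 1 : ℝ)) ≤ L := by
          refine Real.log_le_log (by positivity) ?_
          rw [div_le_iff₀ hK]
          have : 1 ≤ p * (m + 1) := by linarith
          nlinarith
        have h2 : u * t / 2 ≤ ε / 4 * L := by
          calc u * t / 2 ≤ u * (ε / (2 * u) * L) / 2 := by gcongr
            _ = _ := by field_simp; ring
        have h3 : L / (1 - ε) - 1 ≤ p * m / 2 := by linarith
        have h4 : (1 - ε / 4) * (L / (1 - ε) - 1) ≤ (1 - ε / 4) * (p * m / 2) :=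
          mul_le_mul_of_nonneg_left h3 (by linarith)
        nlinarith
    _ ≤ _ := by
        rw [Real.exp_le_exp]
        have : 1 / p ≤ m + 1 := by
          rw [div_le_iff₀ hp]
          linarith
        linarith

end Deterministic

section UpperTail

variable {n : ℕ}

set_option maxHeartbeats 1000000 in
theorem exp_le_bernoulliPr_colourable {k : ℕ} [NeZero k] {p η θ L : ℝ} (hp : 0 < p) (hp1 : p < 1)
    (hn : 0 < n) (hη : 0 < η) (hη1 : η ≤ 1 / 128) (hpη : p ≤ 2 * η ^ 2) (hθ : 0 < θ)
    (hθ1 : θ ≤ 1) (hL : 1 ≤ L) (hd : n * p = Real.exp L)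
    (hk : (1 + 16 * η) * (n * p) / (2 * L) ≤ k) (hk2 : (k : ℝ) ≤ n * p / L)
    (h3 : Real.log (2 * L) ≤ η * L) (h4 : 1 + Real.log (L / θ) ≤ η * L)
    (h5 : Real.exp (-(L / 2)) ≤ θ) (h6 : Real.log 2 ≤ 6 * θ * n) :
    Real.exp (-(12 * θ * n)) ≤ bernoulliPr p (fun f : Sym2 (Fin n) → Bool =>
        ∃ σ : Fin n → Fin k, ∀ e ∈ monoPairs σ, f e = false) := by
  classical
  have hn' : (0 : ℝ) < n := by exact_mod_cast hn
  have hk0 : (0 : ℝ) < k := by exact_mod_cast Nat.pos_of_ne_zero (NeZero.ne k)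
  have hk1 : (1 : ℝ) ≤ k := by exact_mod_cast Nat.pos_of_ne_zero (NeZero.ne k)
  have hL0 : 0 < L := by linarith
  have hd0 : 0 < (n : ℝ) * p := by positivity
  set m : ℝ := n / k with hm
  have hm0 : 0 < m := by positivity
  set M : ℝ := (1 + 4 * η) * m with hM
  have hM0 : 0 < M := by positivity
  set l : ℝ := -Real.log (1 - p) with hl
  have hl0 : 0 < l := by
    rw [hl, neg_pos]; exact Real.log_neg (by linarith) (by linarith)
  have hpη' : p ≤ η := by nlinarith
  have hlp : l ≤ p * (1 + 2 * η) := by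
    have h := Real.one_sub_inv_le_log_of_pos (show 0 < 1 - p by linarith)
    have h' : (1 - p)⁻¹ - 1 ≤ p * (1 + 2 * η) := by
      rw [sub_le_iff_le_add, inv_le_iff_one_le_mul₀ (by linarith)]
      have : p * (1 + 2 * η) ≤ 2 * η := by nlinarith
      nlinarith [mul_nonneg hp.le (sub_nonneg.2 this)]
    rw [hl]; linarith
  have hmp : m * p ≤ 2 * L / (1 + 16 * η) := by
    rw [hm, div_mul_eq_mul_div, div_le_iff₀ hk0, div_mul_eq_mul_div, le_div_iff₀ (by positivity)]
    rw [div_le_iff₀ (by positivity)] at hk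
    linarith
  have hmL : L ≤ m * p := by
    rw [hm, div_mul_eq_mul_div, le_div_iff₀ hk0]
    rw [le_div_iff₀ hL0] at hk2
    linarith
  have hlM : l * M / 2 ≤ (1 - 4 * η) * L := by
    have e1 : l * M / 2 ≤ p * (1 + 2 * η) * M / 2 := by gcongr
    have e2 : p * (1 + 2 * η) * M / 2 = (1 + 2 * η) * (1 + 4 * η) / 2 * (m * p) := by
      rw [hM]; ring
    have e3 : (1 + 2 * η) * (1 + 4 * η) / 2 * (m * p)
        ≤ (1 + 2 * η) * (1 + 4 * η) / 2 * (2 * L / (1 + 16 * η)) := by gcongr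
    have e4 : (1 + 2 * η) * (1 + 4 * η) / 2 * (2 * L / (1 + 16 * η)) ≤ (1 - 4 * η) * L := by
      rw [← mul_div_assoc, div_le_iff₀ (by positivity)]
      have : (1 + 2 * η) * (1 + 4 * η) ≤ (1 - 4 * η) * (1 + 16 * η) := by nlinarith
      nlinarith
    linarith
  have hlogk : (1 - η) * L ≤ Real.log k := by
    have : n * p / (2 * L) ≤ k := by
      refine le_trans ?_ hk
      exact div_le_div_of_nonneg_right (le_mul_of_one_le_left hd0.le (by linarith)) (by positivity)
    have h := Real.log_le_log (by positivity) this
    rw [Real.log_div hd0.ne' (by positivity), hd, Real.log_exp] at h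
    linarith
  have hlog2 : 1 + Real.log (l * M / (2 * θ)) ≤ η * L := by
    refine le_trans ?_ h4
    have : l * M / (2 * θ) ≤ L / θ := by
      rw [div_le_div_iff₀ (by positivity) hθ]
      have : l * M ≤ 2 * L := by linarith [mul_pos hη hL0]
      calc l * M * θ ≤ 2 * L * θ := by gcongr
        _ = _ := by ring
    linarith [Real.log_le_log (by positivity) this]
  have hηM : 1 ≤ η * M := by
    have hmM : m ≤ M := by rw [hM]; exact le_mul_of_one_le_left hm0.le (by linarith)
    have hηm : 1 * p ≤ η * m * p := by
      calc 1 * p ≤ η * 1 := by linarith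
        _ ≤ η * (m * p) := by gcongr; linarith
        _ = _ := by ring
    calc 1 ≤ η * m := le_of_mul_le_mul_right hηm hp
      _ ≤ η * M := by gcongr
  have hG := fun a ha => binomialMean_exp_choose_two_le hk1 hl0 hθ hθ1 hη (by linarith) hL0
    hlM hlogk hlog2 hηM a ha
  have hexpx : ∀ j : ℕ, Real.exp (l * (j : ℝ)) = (1 - p)⁻¹ ^ j := by
    intro j
    rw [mul_comm, Real.exp_nat_mul, hl, Real.exp_neg, Real.exp_log (by linarith)]
  simp only [hexpx] at hG
  set G := 2 * θ * M / k + M * Real.exp (-(3 / 2) * L) with hGdef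
  have hkd : (k : ℝ) ≤ Real.exp L := by
    rw [← hd]
    refine hk2.trans ?_
    rw [div_le_iff₀ hL0]
    nlinarith
  have hk2G : (k : ℝ) ^ 2 * G ≤ 6 * θ * n := by
    have e1 : k * M ≤ 2 * n := by
      have : (k : ℝ) * M = (1 + 4 * η) * n := by rw [hM, hm]; field_simp
      rw [this]; nlinarith
    have e2 : k * Real.exp (-(3 / 2) * L) ≤ θ := by
      refine le_trans ?_ h5
      calc _ ≤ Real.exp L * Real.exp (-(3 / 2) * L) := by gcongr
        _ = _ := by rw [← Real.exp_add]; congr 1; ring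
    calc (k : ℝ) ^ 2 * G = (k * M) * (2 * θ + k * Real.exp (-(3 / 2) * L)) := by
          rw [hGdef]; field_simp
      _ ≤ (2 * n) * (2 * θ + θ) := by gcongr
      _ = _ := by ring
  have hbal : (k : ℝ) * Real.exp (-(n / k * (4 * η) ^ 2 / 4)) ≤ 1 / 2 := by
    have e1 : 2 * L ≤ n / k * (4 * η) ^ 2 / 4 := by
      rw [← hm]
      have : p * (2 * L) ≤ p * (m * (4 * η) ^ 2 / 4) := by
        calc p * (2 * L) ≤ (2 * η ^ 2) * (2 * L) := by gcongr
          _ ≤ (2 * η ^ 2) * (2 * (m * p)) := by gcongr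
          _ = _ := by ring
      exact le_of_mul_le_mul_left this hp
    calc _ ≤ Real.exp L * Real.exp (-(2 * L)) := by gcongr
      _ = Real.exp (-L) := by rw [← Real.exp_add]; congr 1; ring
      _ ≤ Real.exp (-1) := by rw [Real.exp_le_exp]; linarith
      _ ≤ 1 / 2 := by
        rw [Real.exp_neg, one_div]
        exact inv_anti₀ (by norm_num) (by linarith [Real.add_one_le_exp (1 : ℝ)])
  have hBge := card_balanced_ge (n := n) (k := k) (η := 4 * η) (by linarith) (by linarith) hbal
  have hsm := card_le_bernoulliPr_colourable (k := k) hp.le hp1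
    (Finset.univ.filter fun σ : Fin n → Fin k =>
      ∀ i, ((Finset.univ.filter fun v => σ v = i).card : ℝ) ≤ (1 + 4 * η) * (n / k))
    (M := M) (G := G) (fun σ hσ i => (Finset.mem_filter.1 hσ).2 i) hG
  set P := bernoulliPr p (fun f : Sym2 (Fin n) → Bool =>
        ∃ σ : Fin n → Fin k, ∀ e ∈ monoPairs σ, f e = false) with hP
  have hP0 : 0 ≤ P := bernoulliPr_nonneg hp.le hp1.le _
  have hkn : (0 : ℝ) < (k : ℝ) ^ n := by positivity
  have h7 : 1 / 2 ≤ Real.exp (6 * θ * n) * P := by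
    have h8 : (k : ℝ) ^ n * (1 / 2) ≤ (k : ℝ) ^ n * (Real.exp ((k : ℝ) ^ 2 * G) * P) := by
      have := hBge.trans hsm
      rw [mul_assoc] at this
      linarith
    refine (le_of_mul_le_mul_left h8 hkn).trans ?_
    gcongr
  have h9 : Real.exp (-(6 * θ * n)) ≤ 1 / 2 := by
    calc _ ≤ Real.exp (-Real.log 2) := by rw [Real.exp_le_exp]; linarith
      _ = 1 / 2 := by rw [← Real.log_inv, Real.exp_log (by norm_num)]; norm_num
  calc Real.exp (-(12 * θ * n)) = Real.exp (-(6 * θ * n)) * Real.exp (-(6 * θ * n)) := by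
        rw [← Real.exp_add]; congr 1; ring
    _ ≤ Real.exp (-(6 * θ * n)) * (Real.exp (6 * θ * n) * P) := by gcongr; exact h9.trans h7
    _ = P := by rw [← mul_assoc, ← Real.exp_add]; simp

set_option maxHeartbeats 1000000 in
/-- Upper tail of the improper chromatic number. -/
theorem bernoulliPr_lt_improperChromaticNumber_le {p ε δ L : ℝ} (hp : 0 < p) (hp1 : p < 1)
    (hn : 0 < n) (hε : 0 < ε) (hε1 : ε ≤ 1 / 4) (hpε : p ≤ 2 * (ε / 32) ^ 2)
    (hδ : δ = ε * Real.exp (-2) / 16) (hL : 1 ≤ L) (hd : n * p = Real.exp L)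
    (h1 : 64 / ε ≤ Real.exp L / L)
    (h2 : 6 + 2 * Real.log (16 * L / ε) ≤ ε / 32 * (Real.exp L / L))
    (h3 : Real.log (2 * L) ≤ ε / 32 * L)
    (h4 : 1 + Real.log (L / (δ ^ 2 / (96 * L ^ 2))) ≤ ε / 32 * L)
    (h5 : Real.exp (-(L / 2)) ≤ δ ^ 2 / (96 * L ^ 2)) (t : ℕ) :
    bernoulliPr p (fun f : Sym2 (Fin n) → Bool => (1 + ε) * (n * p) / (2 * L) <
      (improperChromaticNumber (SimpleGraph.fromEdgeSet {e | f e = true}) t : ℝ))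
      ≤ Real.exp (-Real.sqrt n) + 2 / n := by
  have hn' : (0 : ℝ) < n := by exact_mod_cast hn
  have hL0 : 0 < L := by linarith
  have hδ0 : 0 < δ := by rw [hδ]; positivity
  have hδ1 : δ ≤ 1 := by
    have : Real.exp (-2) ≤ 1 := Real.exp_le_one_iff.2 (by norm_num)
    rw [hδ]; nlinarith [Real.exp_pos (-2)]
  set θ := δ ^ 2 / (96 * L ^ 2) with hθdef
  have hθ : 0 < θ := by positivity
  have hθ1 : θ ≤ 1 := by
    rw [hθdef, div_le_one (by positivity)]; nlinarith
  set X := n * p / L with hX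
  have hX' : Real.exp L / L = X := by rw [hX, hd]
  rw [hX'] at h1 h2
  have hX0 : 0 < X := by positivity
  have hεX : 64 ≤ ε * X := by rw [div_le_iff₀ hε] at h1; linarith
  have hsqrt : Real.sqrt n ≤ θ * n := by
    have hdn : Real.exp L ≤ n := by
      rw [← hd]; exact mul_le_of_le_one_right hn'.le hp1.le
    have e1 : Real.exp (L / 2) ≤ Real.sqrt n := by
      refine Real.le_sqrt_of_sq_le ?_
      rw [← Real.exp_nat_mul]
      refine le_trans (le_of_eq ?_) hdn
      congr 1; push_cast; ring
    have e2 : (Real.sqrt n)⁻¹ ≤ θ := by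
      refine le_trans ?_ h5
      rw [Real.exp_neg]
      exact inv_anti₀ (Real.exp_pos _) e1
    calc Real.sqrt n = (Real.sqrt n)⁻¹ * n := by rw [inv_mul_eq_div, Real.div_sqrt]
      _ ≤ θ * n := by gcongr
  have h6 : Real.log 2 ≤ 6 * θ * n := by
    have h' : 1 ≤ Real.sqrt n := Real.one_le_sqrt.2 (by exact_mod_cast hn)
    have := Real.log_two_lt_d9
    linarith
  set k := ⌈(1 + 16 * (ε / 32)) * (n * p) / (2 * L)⌉₊ with hk
  have hkge : (1 + 16 * (ε / 32)) * (n * p) / (2 * L) ≤ k := Nat.le_ceil _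
  have hklt : (k : ℝ) < (1 + 16 * (ε / 32)) * (n * p) / (2 * L) + 1 :=
    Nat.ceil_lt_add_one (by positivity)
  have hkX : (1 + 16 * (ε / 32)) * (n * p) / (2 * L) = (1 + ε / 2) / 2 * X := by
    rw [hX]; field_simp; ring
  have : NeZero k := ⟨(Nat.ceil_pos.2 (by positivity)).ne'⟩
  have hkle : (k : ℝ) ≤ X := by
    rw [hkX] at hklt
    nlinarith
  set q := ⌊ε * X / 16⌋₊ with hq
  have hqle : (q : ℝ) ≤ ε * X / 16 := Nat.floor_le (by positivity)
  have hqge : ε * X / 16 - 1 < q := by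
    linarith [Nat.lt_floor_add_one (ε * X / 16)]
  have hq32 : ε * X / 32 ≤ q := by linarith
  have hq2 : 2 ≤ q := by
    have : (2 : ℝ) ≤ q := by linarith
    exact_mod_cast this
  have hq0 : (0 : ℝ) < q := by positivity
  have hcol := exp_le_bernoulliPr_colourable (k := k) hp hp1 hn (η := ε / 32) (by positivity)
    (by linarith) hpε hθ hθ1 hL hd hkge hkle h3 h4 h5 h6
  set r := δ * n / (2 * L) with hr
  have hr0 : 0 < r := by positivity
  have hr2 : r ^ 2 / (2 * n) = 12 * θ * n := by rw [hr, hθdef]; field_simp; norm_num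
  rw [← hr2] at hcol
  have hdel := bernoulliPr_le_deletionNumber hp.le hp1.le hn hr0 hcol
  have hdense := bernoulliPr_exists_dense_le (n := n) (q := q) (x := 2 * r) hp hp1.le hn hq2
    (by
      have e1 : 2 * r * p = δ * X := by rw [hr, hX]; field_simp
      rw [e1, div_le_iff₀ (by positivity), hδ]
      nlinarith [Real.exp_pos (-2)])
    (by
      have e1 : n * p / (2 * q) ≤ 16 * L / ε := by
        rw [div_le_div_iff₀ (by positivity) hε]
        have : X * L = n * p := by rw [hX]; field_simp
        rw [← this]
        nlinarith
      have e2 := Real.log_le_log (by positivity) e1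
      have e3 := Real.log_two_lt_d9
      linarith)
  calc _ ≤ bernoulliPr p (fun f : Sym2 (Fin n) → Bool => 2 * r ≤ (deletionNumber k f : ℝ) ∨
        ∃ S : Finset (Fin n), S.Nonempty ∧ (S.card : ℝ) ≤ 2 * r ∧
          q * S.card ≤ ((pairsIn S).filter fun e => f e = true).card) := by
        refine bernoulliPr_mono hp.le hp1.le fun f hf => ?_
        by_contra hc
        push Not at hc
        have := improperChromaticNumber_le_add (k := k) (q := q) (by omega) f t
          fun S hS hSY => hc.2 S hS ((Nat.cast_le.2 hSY).trans hc.1.le)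
        have h' : (improperChromaticNumber (SimpleGraph.fromEdgeSet {e | f e = true}) t : ℝ)
          ≤ (k + 2 * q : ℕ) := Nat.cast_le.2 this
        push_cast at h'
        have e : (1 + ε) * (n * p) / (2 * L) = (1 + ε) / 2 * X := by rw [hX]; field_simp
        rw [e] at hf
        rw [hkX] at hklt
        nlinarith
    _ ≤ Real.exp (-(r ^ 2 / (2 * n))) + 2 / n :=
        (bernoulliPr_or_le hp.le hp1.le _ _).trans (add_le_add hdel hdense)
    _ ≤ _ := by
        rw [hr2]
        gcongr
        linarith [mul_pos hθ hn']

end UpperTail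

section Main

theorem eventually_const_add_log_le (a c : ℝ) {b : ℝ} (hb : 0 < b) :
    ∀ᶠ L : ℝ in atTop, c + a * Real.log L ≤ b * L := by
  have h := (Real.isLittleO_log_id_atTop.const_mul_left a).bound (half_pos hb)
  filter_upwards [h, eventually_ge_atTop (c / (b / 2)), eventually_ge_atTop 0] with L h1 h2 h3
  rw [div_le_iff₀ (half_pos hb)] at h2
  rw [Real.norm_eq_abs, id, Real.norm_eq_abs, abs_of_nonneg h3] at h1
  linarith [le_abs_self (a * Real.log L)]

theorem eventually_large (ε δ : ℝ) (hε : 0 < ε) (hδ : 0 < δ) :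
    ∀ᶠ L : ℝ in atTop, 1 ≤ L ∧ 6 / ε ≤ L ∧ 64 / ε ≤ Real.exp L / L ∧
      6 + 2 * Real.log (16 * L / ε) ≤ ε / 32 * (Real.exp L / L) ∧
      Real.log (2 * L) ≤ ε / 32 * L ∧
      1 + Real.log (L / (δ ^ 2 / (96 * L ^ 2))) ≤ ε / 32 * L ∧
      Real.exp (-(L / 2)) ≤ δ ^ 2 / (96 * L ^ 2) := by
  have hhalf : Tendsto (fun L : ℝ => L / 2) atTop atTop :=
    tendsto_id.atTop_div_const (by norm_num)
  filter_upwards [eventually_ge_atTop 1, eventually_ge_atTop (6 / ε),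
    (Real.tendsto_exp_div_pow_atTop 1).eventually_ge_atTop (64 / ε),
    (Real.tendsto_exp_div_pow_atTop 2).eventually_ge_atTop (32 / ε),
    eventually_const_add_log_le 2 (6 + 2 * Real.log (16 / ε)) one_pos,
    eventually_const_add_log_le 1 (Real.log 2) (b := ε / 32) (by positivity),
    eventually_const_add_log_le 3 (1 + Real.log (96 / δ ^ 2)) (b := ε / 32) (by positivity),
    hhalf.eventually ((Real.tendsto_exp_div_pow_atTop 2).eventually_ge_atTop (384 / δ ^ 2))]
    with L h1 h2 h3 h4 h5 h6 h7 h8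
  have hL : 0 < L := by linarith
  refine ⟨h1, h2, by simpa using h3, ?_, ?_, ?_, ?_⟩
  · have e1 : Real.log (16 * L / ε) = Real.log (16 / ε) + Real.log L := by
      rw [← Real.log_mul (by positivity) hL.ne']; congr 1; ring
    have e2 : L ≤ ε / 32 * (Real.exp L / L) := by
      calc L = ε / 32 * (32 / ε) * L := by field_simp
        _ ≤ ε / 32 * (Real.exp L / L ^ 2) * L := by gcongr
        _ = _ := by field_simp
    rw [e1]; linarith
  · rw [Real.log_mul (by norm_num) hL.ne']; linarith
  · have e1 : L / (δ ^ 2 / (96 * L ^ 2)) = 96 / δ ^ 2 * L ^ 3 := by field_simp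
    rw [e1, Real.log_mul (by positivity) (by positivity), Real.log_pow]
    push_cast
    linarith
  · rw [Real.exp_neg, inv_le_comm₀ (Real.exp_pos _) (by positivity), inv_div]
    rw [le_div_iff₀ (by positivity)] at h8
    refine le_trans (le_of_eq ?_) h8
    field_simp
    norm_num

theorem tendsto_error {p : ℕ → ℝ} (hp0 : ∀ n, 0 < p n) (hp : Tendsto p atTop (nhds 0)) :
    Tendsto (fun n : ℕ => 1 - (Real.exp (-(1 / p n)) + (Real.exp (-Real.sqrt n) + 2 / n)))
      atTop (nhds 1) := by
  have h1 : Tendsto (fun n : ℕ => Real.exp (-(1 / p n))) atTop (nhds 0) := by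
    refine Real.tendsto_exp_neg_atTop_nhds_zero.comp ?_
    simp only [one_div]
    exact (tendsto_nhdsWithin_iff.2 ⟨hp, Eventually.of_forall hp0⟩).inv_tendsto_nhdsGT_zero
  have h2 : Tendsto (fun n : ℕ => Real.exp (-Real.sqrt n)) atTop (nhds 0) :=
    Real.tendsto_exp_neg_atTop_nhds_zero.comp
      (Real.tendsto_sqrt_atTop.comp tendsto_natCast_atTop_atTop)
  have h3 : Tendsto (fun n : ℕ => (2 : ℝ) / n) atTop (nhds 0) :=
    tendsto_const_div_atTop_nhds_zero_nat 2
  simpa using (h1.add (h2.add h3)).const_sub 1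

end Main

/-- For every `ε > 0` there exist constants `d₀` and `τ > 0` such that:
if `0 < p(n) < 1`, `p(n) = o(1)`, `d(n) = n·p(n) ≥ d₀` for all large `n`, and
`t(n) ≤ τ·ln d(n)` for all large `n`, then a.a.s.
`(1-ε)·d/(2 ln d) ≤ χ^{t(n)}(G(n,p(n))) ≤ (1+ε)·d/(2 ln d)`. -/
theorem stmt3 (ε : ℝ) (hε : 0 < ε) :
    ∃ d₀ τ : ℝ, 0 < τ ∧
      ∀ p : ℕ → ℝ, (∀ n, 0 < p n ∧ p n < 1) →
        Tendsto p atTop (nhds 0) →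
        (∀ᶠ n : ℕ in atTop, d₀ ≤ (n : ℝ) * p n) →
        ∀ t : ℕ → ℕ, (∀ᶠ n : ℕ in atTop, (t n : ℝ) ≤ τ * Real.log ((n : ℝ) * p n)) →
        Tendsto (fun n => erMeasure n (p n)
            {G | (1 - ε) * ((n : ℝ) * p n) / (2 * Real.log ((n : ℝ) * p n))
                  ≤ (improperChromaticNumber G (t n) : ℝ) ∧
                (improperChromaticNumber G (t n) : ℝ)
                  ≤ (1 + ε) * ((n : ℝ) * p n) / (2 * Real.log ((n : ℝ) * p n))})
          atTop (nhds 1) := by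
  set e := min ε (1 / 4) with he
  have he0 : 0 < e := lt_min hε (by norm_num)
  have he1 : e ≤ 1 / 4 := min_le_right _ _
  have heε : e ≤ ε := min_le_left _ _
  set δ := e * Real.exp (-2) / 16 with hδ
  have hδ0 : 0 < δ := by positivity
  obtain ⟨L₀, hL₀⟩ := eventually_atTop.1 (eventually_large e δ he0 hδ0)
  refine ⟨Real.exp L₀, e / (2 * Real.log (4 / e)), ?_, ?_⟩
  · have : 0 < Real.log (4 / e) := Real.log_pos (by rw [lt_div_iff₀ he0]; linarith)
    positivity
  intro p hp hp0 hd t ht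
  have herr := ENNReal.tendsto_ofReal (tendsto_error (fun n => (hp n).1) hp0)
  rw [ENNReal.ofReal_one] at herr
  refine tendsto_of_tendsto_of_tendsto_of_le_of_le' herr tendsto_const_nhds ?_ ?_
  · filter_upwards [hd, ht, eventually_gt_atTop 0,
      hp0.eventually_le_const (u := 2 * (e / 32) ^ 2) (by positivity)] with n hd ht hn hpn
    obtain ⟨hp, hp1⟩ := hp n
    have hn' : (0 : ℝ) < n := by exact_mod_cast hn
    have hdpos : 0 < (n : ℝ) * p n := by positivity
    rw [erMeasure_apply hp.le hp1.le]
    refine ENNReal.ofReal_le_ofReal ?_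
    set L := Real.log ((n : ℝ) * p n) with hL
    have hexp : (n : ℝ) * p n = Real.exp L := (Real.exp_log hdpos).symm
    obtain ⟨h1, h2, h3, h4, h5, h6, h7⟩ :=
      hL₀ L ((Real.le_log_iff_exp_le hdpos).2 hd)
    have hlow := bernoulliPr_improperChromaticNumber_lt_le he0 he1 hp hp1.le hn h2 ht
    have hup := bernoulliPr_lt_improperChromaticNumber_le hp hp1 hn he0 he1 hpn hδ h1 hexp
      h3 h4 h5 h6 h7 (t n)
    set Q : (Sym2 (Fin n) → Bool) → Prop := fun f =>
      SimpleGraph.fromEdgeSet {e | f e = true} ∈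
        {G : SimpleGraph (Fin n) | (1 - ε) * ((n : ℝ) * p n) / (2 * L)
            ≤ (improperChromaticNumber G (t n) : ℝ) ∧
          (improperChromaticNumber G (t n) : ℝ) ≤ (1 + ε) * ((n : ℝ) * p n) / (2 * L)} with hQ
    have hnot : bernoulliPr (p n) (fun f => ¬ Q f) ≤
        Real.exp (-(1 / p n)) + (Real.exp (-Real.sqrt n) + 2 / n) := by
      refine le_trans (bernoulliPr_mono hp.le hp1.le fun f hf => ?_)
        ((bernoulliPr_or_le hp.le hp1.le _ _).trans (add_le_add hlow hup))
      by_contra hc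
      push Not at hc
      refine hf ⟨le_trans ?_ hc.1, hc.2.trans ?_⟩
      · gcongr
      · gcongr
    linarith [bernoulliPr_add_not (p n) Q]
  · refine Eventually.of_forall fun n => ?_
    rw [erMeasure_apply (hp n).1.le (hp n).2.le]
    refine ENNReal.ofReal_le_one.2 ?_
    linarith [bernoulliPr_add_not (p n) (fun f : Sym2 (Fin n) → Bool =>
      SimpleGraph.fromEdgeSet {e | f e = true} ∈
        {G : SimpleGraph (Fin n) |
          (1 - ε) * ((n : ℝ) * p n) / (2 * Real.log ((n : ℝ) * p n))
            ≤ (improperChromaticNumber G (t n) : ℝ) ∧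
          (improperChromaticNumber G (t n) : ℝ)
            ≤ (1 + ε) * ((n : ℝ) * p n) / (2 * Real.log ((n : ℝ) * p n))}),
      bernoulliPr_nonneg (hp n).1.le (hp n).2.le (fun f : Sym2 (Fin n) → Bool =>
        ¬ SimpleGraph.fromEdgeSet {e | f e = true} ∈
        {G : SimpleGraph (Fin n) |
          (1 - ε) * ((n : ℝ) * p n) / (2 * Real.log ((n : ℝ) * p n))
            ≤ (improperChromaticNumber G (t n) : ℝ) ∧
          (improperChromaticNumber G (t n) : ℝ)
            ≤ (1 + ε) * ((n : ℝ) * p n) / (2 * Real.log ((n : ℝ) * p n))})]
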